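/- arXiv:1606.06655 — 8 statements merged into one kernel-verified Lean document; each statement's English description precedes it below -/
import Mathlib

section
/- Let s : ℤ → ℝ be a symmetric transition probability with finite second moment σ², and let f be a Schwartz function on ℝ. Then lim_{n→∞} sup_{x∈ℤ} | 𝒮_n f(x/n) − (1/2) σ² f''(x/n) | = 0. -/
open Filter MeasureTheory

/-- Discrete generator `𝒮_n f (x/n) = n² ∑_{z∈ℤ} s(z) (f((x+z)/n) − f(x/n))`. -/
noncomputable def discreteGen (s : ℤ → ℝ) (f : ℝ → ℝ) (n : ℕ) (x : ℤ) : ℝ :=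
  (n : ℝ) ^ 2 * ∑' z : ℤ, s z * (f (((x : ℝ) + (z : ℝ)) / n) - f ((x : ℝ) / n))

theorem aux_bdd (f : SchwartzMap ℝ ℝ) : ∃ C : ℝ, 0 < C ∧ ∀ x, |f x| ≤ C := by
  obtain ⟨C, hC, h⟩ := f.decay 0 0
  exact ⟨C, hC, fun x => by simpa using h x⟩

theorem aux_deriv (f : SchwartzMap ℝ ℝ) :
    ∃ g : SchwartzMap ℝ ℝ, (∀ x, HasDerivAt (f : ℝ → ℝ) (g x) x) ∧ deriv (f : ℝ → ℝ) = g := by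
  refine ⟨SchwartzMap.derivCLM ℝ ℝ f, fun x => ?_, ?_⟩
  · rw [SchwartzMap.derivCLM_apply]
    exact f.differentiableAt.hasDerivAt
  · ext x
    rw [SchwartzMap.derivCLM_apply]

theorem aux_mv (φ φ' : ℝ → ℝ) (r D : ℝ) (h0 : φ 0 = 0)
    (hd : ∀ t, HasDerivAt φ (φ' t) t) (hb : ∀ t, |t| ≤ r → |φ' t| ≤ D) :
    ∀ t, |t| ≤ r → |φ t| ≤ D * |t| := by
  intro t ht
  have := (convex_closedBall (0:ℝ) r).norm_image_sub_le_of_norm_hasDerivWithin_le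
    (f := φ) (f' := φ') (C := D) (x := 0) (y := t)
    (fun x _ => (hd x).hasDerivWithinAt)
    (fun x hx => hb x (by simpa using hx)) (by simpa using (abs_nonneg t).trans ht)
    (by simpa using ht)
  simpa [h0] using this

theorem aux_taylor (f f1 f2 f3 : ℝ → ℝ) (h1 : ∀ x, HasDerivAt f (f1 x) x)
    (h2 : ∀ x, HasDerivAt f1 (f2 x) x) (h3 : ∀ x, HasDerivAt f2 (f3 x) x) (M K : ℝ)
    (hK0 : 0 ≤ K)
    (hM : ∀ x, |f2 x| ≤ M) (hK : ∀ x, |f3 x| ≤ K) (a h : ℝ) :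
    |f (a + h) - f a - h * f1 a - h ^ 2 / 2 * f2 a| ≤ min (2 * M) (K * |h|) * h ^ 2 := by
  have sh : ∀ {φ φ' : ℝ → ℝ}, (∀ x, HasDerivAt φ (φ' x) x) →
      ∀ t, HasDerivAt (fun t => φ (a + t)) (φ' (a + t)) t := fun hφ t =>
    (hφ (a + t)).comp_const_add a t
  have hA : ∀ t, |t| ≤ |h| → |f2 (a + t) - f2 a| ≤ min (2 * M) (K * |h|) := by
    intro t ht
    refine le_min ?_ ?_
    · have := abs_sub (f2 (a + t)) (f2 a)
      linarith [hM (a + t), hM a]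
    · have := aux_mv (fun t => f2 (a + t) - f2 a) (fun t => f3 (a + t)) |h| K (by simp)
        (fun t => (sh h3 t).sub_const _) (fun t _ => hK _) t ht
      exact this.trans (mul_le_mul_of_nonneg_left ht hK0)
  set C := min (2 * M) (K * |h|)
  have hC0 : 0 ≤ C := (abs_nonneg _).trans (hA 0 (by simp))
  have hB : ∀ t, |t| ≤ |h| → |f1 (a + t) - f1 a - t * f2 a| ≤ C * |h| := by
    intro t ht
    have := aux_mv (fun t => f1 (a + t) - f1 a - t * f2 a) (fun t => f2 (a + t) - f2 a) |h| C
      (by simp) (fun t => by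
        have e := ((sh h2 t).sub_const (f1 a)).sub ((hasDerivAt_id t).mul_const (f2 a))
        refine e.congr_deriv ?_
        simp) hA t ht
    exact this.trans (mul_le_mul_of_nonneg_left ht hC0)
  have := aux_mv (fun t => f (a + t) - f a - t * f1 a - t ^ 2 / 2 * f2 a)
      (fun t => f1 (a + t) - f1 a - t * f2 a) |h| (C * |h|)
      (by simp) (fun t => by
        have e := (((sh h1 t).sub_const (f a)).sub ((hasDerivAt_id t).mul_const (f1 a))).sub
          ((((hasDerivAt_id t).pow 2).div_const 2).mul_const (f2 a))
        refine e.congr_deriv ?_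
        simp) hB h le_rfl
  calc _ ≤ _ := this
    _ = C * h ^ 2 := by rw [mul_assoc, abs_mul_abs_self]; ring

/-- Lemma A.1(a): `lim_{n→∞} sup_{x∈ℤ} |𝒮_n f(x/n) − ½σ² f''(x/n)| = 0`. -/
theorem stmt_0 (s : ℤ → ℝ) (hpos : ∀ z, 0 ≤ s z) (hsym : ∀ z, s (-z) = s z)
    (hzero : s 0 = 0) (hprob : HasSum s 1)
    (hmom : Summable fun z : ℤ => (z : ℝ) ^ 2 * s z)
    (σ2 : ℝ) (hσ2 : σ2 = ∑' z : ℤ, (z : ℝ) ^ 2 * s z)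
    (f : SchwartzMap ℝ ℝ) :
    ∀ ε > 0, ∃ N : ℕ, ∀ n ≥ N, ∀ x : ℤ,
      |discreteGen s f n x - 1 / 2 * σ2 * deriv (deriv (f : ℝ → ℝ)) ((x : ℝ) / n)| ≤ ε := by
  intro ε hε
  obtain ⟨f1, h1, e1⟩ := aux_deriv f
  obtain ⟨f2, h2, e2⟩ := aux_deriv f1
  obtain ⟨f3, h3, -⟩ := aux_deriv f2
  rw [e1, e2]
  obtain ⟨B, hB0, hB⟩ := aux_bdd f
  obtain ⟨M, hM0, hM⟩ := aux_bdd f2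
  obtain ⟨K, hK0, hK⟩ := aux_bdd f3
  set b : ℕ → ℤ → ℝ := fun n z => min (2 * M) (K * |(z : ℝ) / n|) * ((z : ℝ) ^ 2 * s z) with hb
  have hz0 : ∀ z : ℤ, 0 ≤ (z : ℝ) ^ 2 * s z := fun z => mul_nonneg (sq_nonneg _) (hpos z)
  have hb0 : ∀ n z, 0 ≤ b n z := fun n z => mul_nonneg (by positivity) (hz0 z)
  have hble : ∀ n z, b n z ≤ 2 * M * ((z : ℝ) ^ 2 * s z) := fun n z =>
    mul_le_mul_of_nonneg_right (min_le_left _ _) (hz0 z)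
  have hbs : ∀ n, Summable (b n) := fun n =>
    Summable.of_nonneg_of_le (hb0 n) (hble n) (hmom.mul_left _)
  have hlim : Tendsto (fun n => ∑' z, b n z) atTop (nhds (∑' _ : ℤ, (0:ℝ))) := by
    refine tendsto_tsum_of_dominated_convergence (hmom.mul_left (2 * M)) ?_ ?_
    · intro z
      have t1 : Tendsto (fun n : ℕ => (z : ℝ) / n) atTop (nhds 0) :=
        tendsto_const_div_atTop_nhds_zero_nat _
      have t2 := ((tendsto_const_nhds (x := 2 * M)).min (t1.abs.const_mul K)).mul_const
        ((z : ℝ) ^ 2 * s z)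
      have : min (2 * M) (K * |(0:ℝ)|) * ((z : ℝ) ^ 2 * s z) = 0 := by
        rw [abs_zero, mul_zero, min_eq_right (by positivity), zero_mul]
      rwa [this] at t2
    · refine Eventually.of_forall fun n z => ?_
      rw [Real.norm_of_nonneg (hb0 n z)]
      exact hble n z
  rw [tsum_zero] at hlim
  obtain ⟨N, hN⟩ := eventually_atTop.1 (hlim.eventually (ge_mem_nhds hε))
  refine ⟨N + 1, fun n hn x => ?_⟩
  have hn0 : (n : ℝ) ≠ 0 := by
    have : n ≠ 0 := by omega
    exact_mod_cast this
  refine le_trans ?_ (hN n (by omega))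
  have hs1 : Summable fun z : ℤ => (z : ℝ) * s z := by
    refine Summable.of_norm_bounded hmom fun z => ?_
    rw [norm_mul, Real.norm_of_nonneg (hpos z)]
    refine mul_le_mul_of_nonneg_right ?_ (hpos z)
    have hz : |z| ≤ z ^ 2 := by
      rw [← sq_abs, sq]
      rcases (abs_nonneg z).eq_or_lt with h | h
      · rw [← h]; simp
      · nlinarith
    rw [Real.norm_eq_abs]
    exact_mod_cast hz
  have hs10 : ∑' z : ℤ, (z : ℝ) * s z = 0 := by
    have := (Equiv.neg ℤ).tsum_eq (fun z : ℤ => (z : ℝ) * s z)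
    simp only [Equiv.neg_apply, hsym, Int.cast_neg, neg_mul, tsum_neg] at this
    linarith
  set a : ℝ := (x : ℝ) / n with ha
  set T : ℤ → ℝ := fun z => s z * (f (((x : ℝ) + (z : ℝ)) / n) - f a) with hT
  have hTs : Summable T := by
    refine Summable.of_norm_bounded (hprob.summable.mul_right (2 * B)) fun z => ?_
    rw [hT, norm_mul, Real.norm_of_nonneg (hpos z), Real.norm_eq_abs]
    refine mul_le_mul_of_nonneg_left ?_ (hpos z)
    have := abs_sub (f (((x : ℝ) + (z : ℝ)) / n)) (f a)
    linarith [hB (((x : ℝ) + (z : ℝ)) / n), hB a]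
  have key : HasSum (fun z => (n : ℝ) ^ 2 * T z - n * f1 a * ((z : ℝ) * s z)
      - 1 / 2 * f2 a * ((z : ℝ) ^ 2 * s z))
      (discreteGen s f n x - 1 / 2 * σ2 * f2 a) := by
    have := ((hTs.hasSum.mul_left ((n : ℝ) ^ 2)).sub (hs1.hasSum.mul_left (n * f1 a))).sub
      (hmom.hasSum.mul_left (1 / 2 * f2 a))
    rw [hs10, ← hσ2] at this
    have e : discreteGen s f n x - 1 / 2 * σ2 * f2 a
        = (n : ℝ) ^ 2 * ∑' z, T z - n * f1 a * 0 - 1 / 2 * f2 a * σ2 := by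
      have : discreteGen s f n x = (n : ℝ) ^ 2 * ∑' z, T z := rfl
      rw [this]
      ring
    rw [e]
    exact this
  rw [← key.tsum_eq, ← Real.norm_eq_abs]
  refine tsum_of_norm_bounded (hbs n).hasSum fun z => ?_
  have ht := aux_taylor f f1 f2 f3 h1 h2 h3 M K hK0.le hM hK a ((z : ℝ) / n)
  have hns : 0 ≤ (n : ℝ) ^ 2 * s z := mul_nonneg (sq_nonneg _) (hpos z)
  have e : (n : ℝ) ^ 2 * T z - n * f1 a * ((z : ℝ) * s z) - 1 / 2 * f2 a * ((z : ℝ) ^ 2 * s z)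
      = (n : ℝ) ^ 2 * s z * (f (a + (z : ℝ) / n) - f a - (z : ℝ) / n * f1 a
        - ((z : ℝ) / n) ^ 2 / 2 * f2 a) := by
    simp only [hT]
    rw [add_div, ← ha]
    field_simp
  rw [e, Real.norm_eq_abs, abs_mul, abs_of_nonneg hns]
  refine (mul_le_mul_of_nonneg_left ht hns).trans_eq ?_
  simp only [hb]
  field_simp
end

section
/- Let s : ℤ → ℝ be a symmetric transition probability with finite second moment σ², and let f be a Schwartz function on ℝ. Then lim_{n→∞} (1/n) ∑_{x∈ℤ} | 𝒮_n f(x/n) − (1/2) σ² f''(x/n) | = 0. -/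
open Filter MeasureTheory

/-- weight -/
noncomputable def wgt (y : ℝ) : ℝ := 1 / (1 + y ^ 2)

lemma wgt_pos (y : ℝ) : 0 < wgt y := by unfold wgt; positivity

lemma wgt_le_one (y : ℝ) : wgt y ≤ 1 := by
  unfold wgt
  rw [div_le_one (by positivity)]
  nlinarith [sq_nonneg y]

lemma wgt_shift (a t : ℝ) (ht : |t| ≤ 1) : wgt (a + t) ≤ 3 * wgt a := by
  unfold wgt
  rw [mul_one_div, div_le_div_iff₀ (by positivity) (by positivity)]
  have : t ^ 2 ≤ 1 := by rw [← sq_abs]; nlinarith [abs_nonneg t]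
  nlinarith [sq_nonneg (a + 2 * t), sq_nonneg (a + t), sq_nonneg (2 * a + 3 * t)]

lemma summable_wgt_int : Summable fun q : ℤ => wgt q := by
  have h : Summable fun q : ℤ => (1 : ℝ) / (q : ℝ) ^ 2 :=
    (Real.summable_one_div_int_pow (p := 2)).2 (by norm_num)
  refine Summable.of_norm_bounded_eventually h ?_
  filter_upwards [(Set.finite_singleton (0 : ℤ)).compl_mem_cofinite] with q hq
  have hq0 : (q : ℝ) ≠ 0 := by simpa using hq
  rw [Real.norm_of_nonneg (wgt_pos _).le]
  unfold wgt
  have : 0 < (q : ℝ) ^ 2 := by positivity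
  exact one_div_le_one_div_of_le this (by linarith)

lemma wgt_sum (n : ℕ) (hn : 1 ≤ n) :
    (Summable fun x : ℤ => wgt ((x : ℝ) / n)) ∧
      ∑' x : ℤ, wgt ((x : ℝ) / n) ≤ n * (3 * ∑' q : ℤ, wgt q) := by
  have : NeZero n := ⟨by omega⟩
  have hn0 : (0 : ℝ) < n := by exact_mod_cast hn
  have key : ∀ (q : ℤ) (r : Fin n),
      wgt ((((Int.divModEquiv n).symm (q, r) : ℤ) : ℝ) / n) ≤ 3 * wgt q := by
    intro q r
    have : (((Int.divModEquiv n).symm (q, r) : ℤ) : ℝ) / n = q + (r : ℕ) / (n : ℝ) := by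
      rw [Int.divModEquiv_symm_apply]; push_cast; field_simp
    rw [this]
    apply wgt_shift
    rw [abs_of_nonneg (by positivity), div_le_one hn0]
    exact_mod_cast r.2.le
  have hs : Summable fun p : ℤ × Fin n => wgt ((((Int.divModEquiv n).symm p : ℤ) : ℝ) / n) := by
    rw [summable_prod_of_nonneg (fun _ => (wgt_pos _).le)]
    refine ⟨fun q => Summable.of_finite, ?_⟩
    refine Summable.of_nonneg_of_le (fun q => tsum_nonneg fun _ => (wgt_pos _).le) (fun q => ?_)
      (summable_wgt_int.mul_left (n * 3 : ℝ))
    rw [tsum_fintype]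
    calc _ ≤ ∑ r : Fin n, 3 * wgt q := Finset.sum_le_sum fun r _ => key q r
      _ = _ := by simp; ring
  refine ⟨(Int.divModEquiv n).symm.summable_iff.1 hs, ?_⟩
  rw [← (Int.divModEquiv n).symm.tsum_eq, hs.tsum_prod' (fun q => Summable.of_finite),
    ← tsum_mul_left, ← tsum_mul_left]
  refine Summable.tsum_le_tsum (fun q => ?_) ((summable_prod_of_nonneg
    (fun _ => (wgt_pos _).le)).1 hs).2 ((summable_wgt_int.mul_left _).mul_left _)
  rw [tsum_fintype]
  calc _ ≤ ∑ r : Fin n, 3 * wgt q := Finset.sum_le_sum fun r _ => key q r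
    _ = _ := by simp

lemma schwartz_bound (F : SchwartzMap ℝ ℝ) : ∃ C, 0 < C ∧ ∀ y, |F y| ≤ C * wgt y := by
  obtain ⟨C0, h0, H0⟩ := F.decay 0 0
  obtain ⟨C2, h2, H2⟩ := F.decay 2 0
  refine ⟨C0 + C2, by positivity, fun y => ?_⟩
  have a := H0 y
  have b := H2 y
  simp only [norm_iteratedFDeriv_zero, Real.norm_eq_abs, pow_zero, one_mul, sq_abs] at a b
  unfold wgt
  rw [mul_one_div, le_div_iff₀ (by positivity)]
  linarith

lemma mvt (u u' : ℝ → ℝ) (r M : ℝ) (hu : ∀ t, HasDerivAt u (u' t) t)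
    (hM : ∀ t, |t| ≤ r → |u' t| ≤ M) (h0 : u 0 = 0) (t : ℝ) (ht : |t| ≤ r) :
    |u t| ≤ M * |t| := by
  have h := Convex.norm_image_sub_le_of_norm_hasDerivWithin_le (f := u) (f' := u')
    (s := Set.Icc (-r) r) (C := M) (x := 0) (y := t)
    (fun x _ => (hu x).hasDerivWithinAt) (fun x hx => hM x (abs_le.2 hx)) (convex_Icc _ _)
    (abs_le.1 (by rw [abs_zero]; exact (abs_nonneg t).trans ht)) (abs_le.1 ht)
  simpa [h0] using h

/-- Taylor remainder -/
noncomputable def rem (f : ℝ → ℝ) (a h : ℝ) : ℝ :=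
  f (a + h) - f a - h * deriv f a - h ^ 2 / 2 * deriv (deriv f) a

lemma rem_bounds (f : SchwartzMap ℝ ℝ) : ∃ C, 0 < C ∧
    (∀ a h, |h| ≤ 1 → |rem f a h| ≤ C * h ^ 2 * |h| * wgt a) ∧
    (∀ a h, |rem f a h| ≤ C * h ^ 2 * (wgt (a + h) + 3 * wgt a)) := by
  let f1 := SchwartzMap.derivCLM ℝ ℝ f
  let f2 := SchwartzMap.derivCLM ℝ ℝ f1
  let f3 := SchwartzMap.derivCLM ℝ ℝ f2
  have d0 : ∀ x, HasDerivAt f (f1 x) x := fun x => f.hasDerivAt x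
  have d1 : ∀ x, HasDerivAt f1 (f2 x) x := fun x => f1.hasDerivAt x
  have d2 : ∀ x, HasDerivAt f2 (f3 x) x := fun x => f2.hasDerivAt x
  have hrem : ∀ a h, rem f a h = f (a + h) - f a - h * f1 a - h ^ 2 / 2 * f2 a := fun a h => rfl
  obtain ⟨C0, p0, b0⟩ := schwartz_bound f
  obtain ⟨C1, p1, b1⟩ := schwartz_bound f1
  obtain ⟨C2, p2, b2⟩ := schwartz_bound f2
  obtain ⟨C3, p3, b3⟩ := schwartz_bound f3
  clear_value f1 f2 f3
  have A : ∀ a h, |h| ≤ 1 → |rem f a h| ≤ (3 * C3) * h ^ 2 * |h| * wgt a := by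
    intro a h hh
    have hadd : ∀ t, HasDerivAt (fun t : ℝ => a + t) 1 t := fun t => by
      simpa using (hasDerivAt_id t).const_add a
    set M := 3 * C3 * wgt a with hM
    have hM0 : 0 ≤ M := by have := (wgt_pos a).le; positivity
    have e2 : ∀ t, |t| ≤ |h| → |f2 (a + t) - f2 a| ≤ M * |t| := by
      refine mvt (fun t => f2 (a + t) - f2 a) (fun t => f3 (a + t)) |h| M ?_ ?_ (by simp)
      · intro t
        simpa using ((d2 (a + t)).comp t (hadd t)).sub_const (f2 a)
      · intro t ht
        have := wgt_shift a t (ht.trans hh)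
        calc _ ≤ C3 * wgt (a + t) := b3 _
          _ ≤ C3 * (3 * wgt a) := by gcongr
          _ = M := by rw [hM]; ring
    have e1 : ∀ t, |t| ≤ |h| → |f1 (a + t) - f1 a - t * f2 a| ≤ (M * |h|) * |t| := by
      refine mvt (fun t => f1 (a + t) - f1 a - t * f2 a) (fun t => f2 (a + t) - f2 a) |h| _
        ?_ ?_ (by simp)
      · intro t
        have := (((d1 (a + t)).comp t (hadd t)).sub_const (f1 a)).sub
          ((hasDerivAt_id t).mul_const (f2 a))
        exact this.congr_deriv (by simp)
      · intro t ht
        exact (e2 t ht).trans (by gcongr)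
    have e0 : ∀ t, |t| ≤ |h| →
        |f (a + t) - f a - t * f1 a - t ^ 2 / 2 * f2 a| ≤ (M * |h| * |h|) * |t| := by
      refine mvt (fun t => f (a + t) - f a - t * f1 a - t ^ 2 / 2 * f2 a)
        (fun t => f1 (a + t) - f1 a - t * f2 a) |h| _ ?_ ?_ (by simp)
      · intro t
        have := ((((d0 (a + t)).comp t (hadd t)).sub_const (f a)).sub
          ((hasDerivAt_id t).mul_const (f1 a))).sub
          ((((hasDerivAt_id t).pow 2).div_const 2).mul_const (f2 a))
        exact this.congr_deriv (by simp)
      · intro t ht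
        exact (e1 t ht).trans (by gcongr)
    rw [hrem]
    refine (e0 h le_rfl).trans (le_of_eq ?_)
    rw [hM, ← sq_abs h]; ring
  refine ⟨C0 + C1 + C2 + 3 * C3, by positivity, ?_, ?_⟩
  · intro a h hh
    have := (wgt_pos a).le
    refine (A a h hh).trans ?_
    gcongr
    linarith
  · intro a h
    have w1 := (wgt_pos a).le
    have w2 := (wgt_pos (a + h)).le
    rcases le_total |h| 1 with hh | hh
    · calc _ ≤ (3 * C3) * h ^ 2 * |h| * wgt a := A a h hh
        _ ≤ (3 * C3) * h ^ 2 * 1 * wgt a := by gcongr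
        _ = (3 * C3) * h ^ 2 * wgt a := by ring
        _ ≤ _ := by
          gcongr
          · linarith
          · linarith
    · have h1 : 1 ≤ h ^ 2 := by rw [← sq_abs]; nlinarith
      have h2 : |h| ≤ h ^ 2 := by rw [← sq_abs h]; nlinarith
      have t0 := b0 (a + h)
      have t1 := b0 a
      have t2 := b1 a
      have t3 := b2 a
      have T : |rem f a h| ≤ |f (a + h)| + |f a| + |h| * |f1 a| + h ^ 2 / 2 * |f2 a| := by
        rw [hrem]
        have e : h ^ 2 / 2 * |f2 a| = |h ^ 2 / 2 * f2 a| := by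
          rw [abs_mul, abs_of_nonneg (by positivity : 0 ≤ h ^ 2 / 2)]
        rw [← abs_mul, e]
        refine (abs_sub _ _).trans ?_
        gcongr
        refine (abs_sub _ _).trans ?_
        gcongr
        exact abs_sub _ _
      have : |rem f a h| ≤ h ^ 2 * (C0 * wgt (a + h)) + h ^ 2 * (C0 * wgt a)
          + h ^ 2 * (C1 * wgt a) + h ^ 2 * (C2 * wgt a) := by
        refine T.trans ?_
        have hx : h ^ 2 / 2 ≤ h ^ 2 := by linarith
        have q0 : |f (a + h)| ≤ h ^ 2 * (C0 * wgt (a + h)) :=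
          t0.trans (le_mul_of_one_le_left (by positivity) h1)
        have q1 : |f a| ≤ h ^ 2 * (C0 * wgt a) :=
          t1.trans (le_mul_of_one_le_left (by positivity) h1)
        gcongr
      refine this.trans ?_
      have hp : 0 ≤ h ^ 2 := by positivity
      have : C0 * wgt (a + h) + C0 * wgt a + C1 * wgt a + C2 * wgt a
          ≤ (C0 + C1 + C2 + 3 * C3) * (wgt (a + h) + 3 * wgt a) := by
        have := mul_nonneg p0.le w1
        have := mul_nonneg p1.le w1
        have := mul_nonneg p2.le w1
        have := mul_nonneg p3.le w1
        have := mul_nonneg p1.le w2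
        have := mul_nonneg p2.le w2
        have := mul_nonneg p3.le w2
        nlinarith
      nlinarith [mul_le_mul_of_nonneg_left this hp]

lemma gen_eq (s : ℤ → ℝ) (hpos : ∀ z, 0 ≤ s z) (hsym : ∀ z, s (-z) = s z)
    (hprob : HasSum s 1)
    (hmom : Summable fun z : ℤ => (z : ℝ) ^ 2 * s z)
    (σ2 : ℝ) (hσ2 : σ2 = ∑' z : ℤ, (z : ℝ) ^ 2 * s z)
    (f : SchwartzMap ℝ ℝ) (n : ℕ) (hn : 1 ≤ n) (x : ℤ) :
    discreteGen s f n x - 1 / 2 * σ2 * deriv (deriv (f : ℝ → ℝ)) ((x : ℝ) / n)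
      = ∑' z : ℤ, s z * ((n : ℝ) ^ 2 * rem f ((x : ℝ) / n) ((z : ℝ) / n)) := by
  have hn0 : (n : ℝ) ≠ 0 := by positivity
  obtain ⟨C0, p0, b0⟩ := schwartz_bound f
  have hb : ∀ y, |f y| ≤ C0 := fun y => (b0 y).trans (by nlinarith [wgt_le_one y])
  have S1 : Summable fun z : ℤ => s z * (f (((x : ℝ) + (z : ℝ)) / n) - f ((x : ℝ) / n)) := by
    refine Summable.of_norm_bounded (hprob.summable.mul_right (2 * C0)) (fun z => ?_)
    rw [Real.norm_eq_abs, abs_mul, abs_of_nonneg (hpos z)]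
    refine mul_le_mul_of_nonneg_left ?_ (hpos z)
    refine (abs_sub _ _).trans ?_
    linarith [hb (((x : ℝ) + (z : ℝ)) / n), hb ((x : ℝ) / n)]
  have S2 : Summable fun z : ℤ => (z : ℝ) * s z := by
    refine Summable.of_norm_bounded hmom (fun z => ?_)
    rw [Real.norm_eq_abs, abs_mul, abs_of_nonneg (hpos z)]
    refine mul_le_mul_of_nonneg_right ?_ (hpos z)
    rw [← sq_abs]
    have : |z| ≤ |z| ^ 2 := by
      rcases eq_or_ne z 0 with rfl | h
      · simp
      · nlinarith [Int.one_le_abs h]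
    exact_mod_cast this
  have Z : ∑' z : ℤ, (z : ℝ) * s z = 0 := by
    have h := (Equiv.neg ℤ).tsum_eq (fun z : ℤ => (z : ℝ) * s z)
    simp only [Equiv.neg_apply, hsym, Int.cast_neg, neg_mul, tsum_neg] at h
    linarith
  have H := ((S1.hasSum.mul_left ((n : ℝ) ^ 2)).sub
    (S2.hasSum.mul_right ((n : ℝ) * deriv (f : ℝ → ℝ) ((x : ℝ) / n)))).sub
    (hmom.hasSum.mul_right (1 / 2 * deriv (deriv (f : ℝ → ℝ)) ((x : ℝ) / n)))
  rw [Z, ← hσ2] at H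
  have := H.tsum_eq
  unfold discreteGen
  rw [zero_mul, sub_zero] at this
  rw [show 1 / 2 * σ2 * deriv (deriv (f : ℝ → ℝ)) ((x : ℝ) / n)
    = σ2 * (1 / 2 * deriv (deriv (f : ℝ → ℝ)) ((x : ℝ) / n)) by ring, ← this]
  refine tsum_congr fun z => ?_
  unfold rem
  rw [add_div]
  field_simp

theorem stmt_1 (s : ℤ → ℝ) (hpos : ∀ z, 0 ≤ s z) (hsym : ∀ z, s (-z) = s z)
    (hzero : s 0 = 0) (hprob : HasSum s 1)
    (hmom : Summable fun z : ℤ => (z : ℝ) ^ 2 * s z)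
    (σ2 : ℝ) (hσ2 : σ2 = ∑' z : ℤ, (z : ℝ) ^ 2 * s z)
    (f : SchwartzMap ℝ ℝ) :
    Tendsto (fun n : ℕ => (1 / (n : ℝ)) * ∑' x : ℤ,
        |discreteGen s f n x - 1 / 2 * σ2 * deriv (deriv (f : ℝ → ℝ)) ((x : ℝ) / n)|)
      atTop (nhds 0) := by
  obtain ⟨C, hC, R1, R2⟩ := rem_bounds f
  set K : ℝ := 3 * ∑' q : ℤ, wgt q with hK
  have hK0 : 0 ≤ K := by
    have : 0 ≤ ∑' q : ℤ, wgt q := tsum_nonneg fun _ => (wgt_pos _).le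
    positivity
  obtain ⟨E, hE⟩ : ∃ E : ℕ → ℤ → ℤ → ℝ, ∀ n z x,
      E n z x = (n : ℝ) ^ 2 * |rem f ((x : ℝ) / n) ((z : ℝ) / n)| := ⟨_, fun _ _ _ => rfl⟩
  have E0 : ∀ n z x, 0 ≤ E n z x := fun n z x => by rw [hE]; positivity
  have EB1 : ∀ n : ℕ, 1 ≤ n → ∀ z x, E n z x ≤
      C * (z : ℝ) ^ 2 * (wgt (((x + z : ℤ) : ℝ) / n) + 3 * wgt ((x : ℝ) / n)) := by
    intro n hn z x
    have hn0 : (n : ℝ) ≠ 0 := by positivity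
    calc E n z x ≤ (n : ℝ) ^ 2 * (C * ((z : ℝ) / n) ^ 2 *
          (wgt ((x : ℝ) / n + (z : ℝ) / n) + 3 * wgt ((x : ℝ) / n))) := by
          have := R2 ((x : ℝ) / n) ((z : ℝ) / n)
          rw [hE]
          gcongr
      _ = _ := by
          push_cast
          rw [add_div]
          field_simp
  have EB2 : ∀ n : ℕ, 1 ≤ n → ∀ z : ℤ, |(z : ℝ)| ≤ n → ∀ x, E n z x ≤
      (C * (z : ℝ) ^ 2 * |(z : ℝ)| / n) * wgt ((x : ℝ) / n) := by
    intro n hn z hz x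
    have hn0 : (0 : ℝ) < n := by positivity
    have hzn : |(z : ℝ) / n| = |(z : ℝ)| / n := by rw [abs_div, abs_of_pos hn0]
    calc E n z x ≤ (n : ℝ) ^ 2 * (C * ((z : ℝ) / n) ^ 2 * |(z : ℝ) / n| * wgt ((x : ℝ) / n)) := by
          have := R1 ((x : ℝ) / n) ((z : ℝ) / n) (by rw [hzn, div_le_one hn0]; exact hz)
          rw [hE]
          gcongr
      _ = _ := by
          rw [hzn]
          field_simp
  have WS : ∀ n : ℕ, 1 ≤ n → ∀ z : ℤ, HasSum (fun x : ℤ => C * (z : ℝ) ^ 2 *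
      (wgt (((x + z : ℤ) : ℝ) / n) + 3 * wgt ((x : ℝ) / n)))
      (C * (z : ℝ) ^ 2 * (∑' x : ℤ, wgt ((x : ℝ) / n) + 3 * ∑' x : ℤ, wgt ((x : ℝ) / n))) := by
    intro n hn z
    have h := (wgt_sum n hn).1.hasSum
    have h' := (Equiv.addRight z).hasSum_iff.2 h
    exact (h'.add (h.mul_left 3)).mul_left _
  have ES : ∀ n : ℕ, 1 ≤ n → ∀ z, Summable (E n z) := fun n hn z =>
    Summable.of_nonneg_of_le (E0 n z) (EB1 n hn z) (WS n hn z).summable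
  obtain ⟨A, hA⟩ : ∃ A : ℕ → ℤ → ℝ, ∀ n z, A n z = (1 / (n : ℝ)) * ∑' x, E n z x :=
    ⟨_, fun _ _ => rfl⟩
  have A0 : ∀ n z, 0 ≤ A n z := fun n z => by
    rw [hA]; exact mul_nonneg (by positivity) (tsum_nonneg (E0 n z))
  have AB1 : ∀ n : ℕ, 1 ≤ n → ∀ z, A n z ≤ 4 * C * K * (z : ℝ) ^ 2 := by
    intro n hn z
    have hn0 : (0 : ℝ) < n := by positivity
    have h1 := (ES n hn z).tsum_le_tsum (EB1 n hn z) (WS n hn z).summable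
    rw [(WS n hn z).tsum_eq] at h1
    have h2 := (wgt_sum n hn).2
    rw [hA]
    rw [one_div_mul_eq_div, div_le_iff₀ hn0]
    refine h1.trans ?_
    have : 0 ≤ C * (z : ℝ) ^ 2 := by positivity
    nlinarith [mul_le_mul_of_nonneg_left h2 this]
  have AB2 : ∀ n : ℕ, 1 ≤ n → ∀ z : ℤ, |(z : ℝ)| ≤ n →
      A n z ≤ (C * (z : ℝ) ^ 2 * |(z : ℝ)| * K) / n := by
    intro n hn z hz
    have hn0 : (0 : ℝ) < n := by positivity
    have h1 := (ES n hn z).tsum_le_tsum (EB2 n hn z hz) ((wgt_sum n hn).1.mul_left _)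
    rw [tsum_mul_left] at h1
    have h2 := (wgt_sum n hn).2
    rw [hA]
    calc _ ≤ 1 / (n : ℝ) * ((C * (z : ℝ) ^ 2 * |(z : ℝ)| / n) * (n * K)) := by
          gcongr
          refine h1.trans ?_
          gcongr
      _ = _ := by field_simp
  have hbd : Summable fun z : ℤ => s z * (4 * C * K * (z : ℝ) ^ 2) := by
    refine (hmom.mul_left (4 * C * K)).congr fun z => by ring
  have T : Tendsto (fun n : ℕ => ∑' z, s z * A n z) atTop (nhds 0) := by
    have := tendsto_tsum_of_dominated_convergence (f := fun (n : ℕ) z => s z * A n z)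
      (g := fun _ => (0 : ℝ)) (𝓕 := atTop) hbd ?_ ?_
    · simpa using this
    · intro z
      have : Tendsto (fun n : ℕ => A n z) atTop (nhds 0) := by
        refine tendsto_of_tendsto_of_tendsto_of_le_of_le' tendsto_const_nhds
          (tendsto_const_div_atTop_nhds_zero_nat (C * (z : ℝ) ^ 2 * |(z : ℝ)| * K))
          (Eventually.of_forall fun n => A0 n z) ?_
        filter_upwards [eventually_ge_atTop 1, eventually_ge_atTop z.natAbs] with n hn hz
        refine AB2 n hn z ?_
        rw [← Int.cast_abs, Int.abs_eq_natAbs]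
        exact_mod_cast hz
      simpa using this.const_mul (s z)
    · filter_upwards [eventually_ge_atTop 1] with n hn z
      rw [Real.norm_of_nonneg (mul_nonneg (hpos z) (A0 n z))]
      exact mul_le_mul_of_nonneg_left (AB1 n hn z) (hpos z)
  refine tendsto_of_tendsto_of_tendsto_of_le_of_le' tendsto_const_nhds T
    (Eventually.of_forall fun n => mul_nonneg (by positivity) (tsum_nonneg fun _ => abs_nonneg _)) ?_
  filter_upwards [eventually_ge_atTop 1] with n hn
  have hn0 : (0 : ℝ) < n := by positivity
  have hSA : Summable fun z => s z * A n z :=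
    Summable.of_nonneg_of_le (fun z => mul_nonneg (hpos z) (A0 n z))
      (fun z => mul_le_mul_of_nonneg_left (AB1 n hn z) (hpos z)) hbd
  have hP : Summable fun p : ℤ × ℤ => s p.1 * E n p.1 p.2 := by
    rw [summable_prod_of_nonneg (fun p => mul_nonneg (hpos _) (E0 _ _ _))]
    refine ⟨fun z => (ES n hn z).mul_left (s z), (hSA.mul_left (n : ℝ)).congr fun z => ?_⟩
    rw [hA]
    dsimp only
    rw [tsum_mul_left]
    field_simp
  have hP' : Summable fun p : ℤ × ℤ => s p.2 * E n p.2 p.1 := hP.prod_symm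
  have hx : ∀ x : ℤ, Summable fun z => s z * E n z x := fun x => hP'.prod_factor x
  have hle : ∀ x : ℤ,
      |discreteGen s f n x - 1 / 2 * σ2 * deriv (deriv (f : ℝ → ℝ)) ((x : ℝ) / n)|
        ≤ ∑' z, s z * E n z x := by
    intro x
    rw [gen_eq s hpos hsym hprob hmom σ2 hσ2 f n hn x]
    have habs : ∀ z : ℤ, ‖s z * ((n : ℝ) ^ 2 * rem f ((x : ℝ) / n) ((z : ℝ) / n))‖
        = s z * E n z x := by
      intro z
      rw [Real.norm_eq_abs, abs_mul, abs_of_nonneg (hpos z), abs_mul,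
        abs_of_nonneg (by positivity : (0 : ℝ) ≤ (n : ℝ) ^ 2), hE]
    have := norm_tsum_le_tsum_norm (f := fun z : ℤ =>
      s z * ((n : ℝ) ^ 2 * rem f ((x : ℝ) / n) ((z : ℝ) / n)))
      ((hx x).congr fun z => (habs z).symm)
    simpa only [habs, Real.norm_eq_abs] using this
  have hS2 : Summable fun x : ℤ => ∑' z, s z * E n z x := hP'.prod
  have hS1 := Summable.of_nonneg_of_le (fun x => abs_nonneg _) hle hS2
  have fin := hS1.tsum_le_tsum hle hS2
  have comm : ∑' x : ℤ, ∑' z, s z * E n z x = ∑' z, ∑' x : ℤ, s z * E n z x :=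
    Summable.tsum_comm (f := fun z x => s z * E n z x) hP
  rw [comm] at fin
  calc _ ≤ 1 / (n : ℝ) * ∑' z, ∑' x : ℤ, s z * E n z x := by gcongr
    _ = _ := by
      rw [← tsum_mul_left]
      refine tsum_congr fun z => ?_
      rw [hA]
      rw [tsum_mul_left]
      ring
end

section
/- Let s : ℤ → ℝ be a symmetric transition probability with finite second moment σ², and let f be a Schwartz function on ℝ. Then there exists a finite constant C(f), depending only on f and s, such that for every n ≥ 1 and every x ∈ ℤ one has | 𝒮_n f(x/n) | ≤ C(f) / (1 + (x/n)²). -/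
open Filter MeasureTheory

lemma schw_decay (g : SchwartzMap ℝ ℝ) : ∃ A : ℝ, 0 ≤ A ∧ ∀ y, |g y| * (1 + y ^ 2) ≤ A := by
  obtain ⟨a, ha, h0⟩ := g.decay 0 0
  obtain ⟨b, hb, h2⟩ := g.decay 2 0
  refine ⟨a + b, by linarith, fun y => ?_⟩
  have h0 := h0 y
  have h2 := h2 y
  simp only [norm_iteratedFDeriv_zero, pow_zero, one_mul, Real.norm_eq_abs, sq_abs] at h0 h2
  linarith

lemma second_diff (f f1 f2 : ℝ → ℝ) (h1 : ∀ y, HasDerivAt f (f1 y) y)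
    (h2 : ∀ y, HasDerivAt f1 (f2 y) y) (u w B : ℝ)
    (hB : ∀ y ∈ Set.Icc (u - |w|) (u + |w|), |f2 y| ≤ B) :
    |f (u + w) + f (u - w) - 2 * f u| ≤ 2 * B * w ^ 2 := by
  have hB0 : 0 ≤ B := (abs_nonneg _).trans (hB u ⟨by linarith [abs_nonneg w], by linarith [abs_nonneg w]⟩)
  have hd : ∀ t ∈ Set.Icc (-|w|) |w|, |f1 (u + t) - f1 (u - t)| ≤ 2 * B * |w| := by
    intro t ht
    have := (convex_Icc (u - |w|) (u + |w|)).norm_image_sub_le_of_norm_hasDerivWithin_le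
      (f := f1) (f' := f2) (C := B) (fun y _ => (h2 y).hasDerivWithinAt) hB
      (x := u - t) (y := u + t) ⟨by linarith [ht.2], by linarith [ht.1]⟩
      ⟨by linarith [ht.1], by linarith [ht.2]⟩
    simp only [Real.norm_eq_abs] at this
    refine this.trans ?_
    have e : u + t - (u - t) = 2 * t := by ring
    rw [e, abs_mul, abs_two]
    have := abs_le.2 ht
    nlinarith
  have := (convex_Icc (-|w|) (|w|)).norm_image_sub_le_of_norm_hasDerivWithin_le
      (f := fun t => f (u + t) + f (u - t)) (f' := fun t => f1 (u + t) - f1 (u - t))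
      (C := 2 * B * |w|) (fun t _ => by
        have a := (h1 (u + t)).comp_const_add u t
        have b := (h1 (u - t)).comp_const_sub u t
        have c := a.add b
        rw [← sub_eq_add_neg] at c
        exact c.hasDerivWithinAt) hd
      (x := 0) (y := w) ⟨by simp, by simp⟩ ⟨neg_abs_le w, le_abs_self w⟩
  simp only [Real.norm_eq_abs, add_zero, sub_zero] at this
  have e : f (u + w) + f (u - w) - 2 * f u = f (u + w) + f (u - w) - (f u + f u) := by ring
  rw [e]
  refine this.trans (le_of_eq ?_)
  rw [mul_assoc, abs_mul_abs_self]; ring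

lemma key (f : SchwartzMap ℝ ℝ) : ∃ K : ℝ, ∀ u w : ℝ,
    |f (u + w) + f (u - w) - 2 * f u| ≤ K * w ^ 2 / (1 + u ^ 2) := by
  obtain ⟨M, hM, hf⟩ := schw_decay f
  obtain ⟨A, hA, hf2⟩ := schw_decay (SchwartzMap.derivCLM ℝ ℝ (SchwartzMap.derivCLM ℝ ℝ f))
  set f1 := SchwartzMap.derivCLM ℝ ℝ f with hf1
  set f2 := SchwartzMap.derivCLM ℝ ℝ f1 with hf2'
  have h1 : ∀ y, HasDerivAt f (f1 y) y := fun y => by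
    rw [hf1, SchwartzMap.derivCLM_apply]; exact f.differentiableAt.hasDerivAt
  have h2 : ∀ y, HasDerivAt f1 (f2 y) y := fun y => by
    rw [hf2', SchwartzMap.derivCLM_apply]; exact f1.differentiableAt.hasDerivAt
  have hfM : ∀ y, |f y| ≤ M := fun y => by nlinarith [hf y, abs_nonneg (f y), sq_nonneg y, mul_nonneg (abs_nonneg (f y)) (sq_nonneg y)]
  have hfA : ∀ y, |f2 y| ≤ A := fun y => by nlinarith [hf2 y, mul_nonneg (abs_nonneg (f2 y)) (sq_nonneg y)]
  refine ⟨8 * A + 16 * M, fun u w => ?_⟩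
  have hu : 0 < 1 + u ^ 2 := by positivity
  by_cases hw : |w| ≤ |u| / 2
  · have := second_diff f f1 f2 h1 h2 u w (4 * A / (1 + u ^ 2)) (fun y hy => by
      rw [le_div_iff₀ hu]
      have hd : |u - y| ≤ |w| := abs_le.2 ⟨by linarith [hy.2], by linarith [hy.1]⟩
      have hy2 : |u| / 2 ≤ |y| := by
        have := abs_sub_abs_le_abs_sub u y
        linarith
      have hsq : u ^ 2 ≤ 4 * y ^ 2 := by
        rw [← sq_abs u, ← sq_abs y]
        nlinarith [abs_nonneg u]
      nlinarith [hf2 y, mul_le_mul_of_nonneg_left hsq (abs_nonneg (f2 y)), abs_nonneg (f2 y)])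
    refine this.trans ?_
    rw [le_div_iff₀ hu]
    have e : 2 * (4 * A / (1 + u ^ 2)) * w ^ 2 * (1 + u ^ 2) = 8 * A * w ^ 2 := by
      field_simp; ring
    rw [e]
    nlinarith [mul_nonneg hM (sq_nonneg w)]
  · push Not at hw
    have a := second_diff f f1 f2 h1 h2 u w A (fun y _ => hfA y)
    have b : |f (u + w) + f (u - w) - 2 * f u| ≤ 4 * M := by
      have p := abs_le.1 (hfM (u + w))
      have q := abs_le.1 (hfM (u - w))
      have r := abs_le.1 (hfM u)
      exact abs_le.2 ⟨by linarith, by linarith⟩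
    have hsq : u ^ 2 ≤ 4 * w ^ 2 := by
      rw [← sq_abs u, ← sq_abs w]
      nlinarith [abs_nonneg u]
    rw [le_div_iff₀ hu]
    have c := mul_le_mul_of_nonneg_right b (sq_nonneg u)
    nlinarith [mul_le_mul_of_nonneg_left hsq hM, mul_nonneg hA (sq_nonneg w)]

/-- There is a constant `C(f)` with `|𝒮_n f(x/n)| ≤ C(f)/(1 + (x/n)²)` for all `n ≥ 1`, `x ∈ ℤ`. -/
theorem stmt_2 (s : ℤ → ℝ) (hpos : ∀ z, 0 ≤ s z) (hsym : ∀ z, s (-z) = s z)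
    (hzero : s 0 = 0) (hprob : HasSum s 1)
    (hmom : Summable fun z : ℤ => (z : ℝ) ^ 2 * s z)
    (f : SchwartzMap ℝ ℝ) :
    ∃ C : ℝ, ∀ n : ℕ, 1 ≤ n → ∀ x : ℤ,
      |discreteGen s f n x| ≤ C / (1 + ((x : ℝ) / n) ^ 2) := by
  obtain ⟨K, hK⟩ := key f
  obtain ⟨M, hM, hf⟩ := schw_decay f
  have hfM : ∀ y, |f y| ≤ M := fun y => by nlinarith [hf y, mul_nonneg (abs_nonneg (f y)) (sq_nonneg y)]
  refine ⟨K * (∑' z : ℤ, (z : ℝ) ^ 2 * s z) / 2, fun n hn x => ?_⟩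
  have hn0 : (0 : ℝ) < n := by exact_mod_cast hn
  unfold discreteGen
  set u : ℝ := (x : ℝ) / n with hu
  set T : ℤ → ℝ := fun z => s z * (f (((x : ℝ) + (z : ℝ)) / n) - f u) with hT
  have hTs : Summable T := by
    refine Summable.of_norm_bounded (hprob.summable.mul_right (2 * M)) (fun z => ?_)
    rw [hT, norm_mul, Real.norm_eq_abs, Real.norm_eq_abs, abs_of_nonneg (hpos z)]
    refine mul_le_mul_of_nonneg_left ?_ (hpos z)
    exact (abs_sub _ _).trans (by linarith [hfM (((x : ℝ) + (z : ℝ)) / n), hfM u])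
  have hneg : ∑' z, T (-z) = ∑' z, T z := (Equiv.neg ℤ).tsum_eq T
  have hTs' : Summable fun z => T (-z) := (Equiv.neg ℤ).summable_iff.2 hTs
  have hsum : 2 * ∑' z, T z = ∑' z, (T z + T (-z)) := by
    rw [hTs.tsum_add hTs', hneg]; ring
  have hb : ∀ z, ‖T z + T (-z)‖ ≤ (K / (n ^ 2 * (1 + u ^ 2))) * ((z : ℝ) ^ 2 * s z) := by
    intro z
    have h := hK u (z / n)
    have e : T z + T (-z) = s z * (f (u + z / n) + f (u - z / n) - 2 * f u) := by
      simp only [hT, hsym, Int.cast_neg, add_div, neg_div, ← hu, ← sub_eq_add_neg]; ring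
    rw [e, norm_mul, Real.norm_eq_abs, Real.norm_eq_abs, abs_of_nonneg (hpos z)]
    refine (mul_le_mul_of_nonneg_left h (hpos z)).trans (le_of_eq ?_)
    have : 0 < 1 + u ^ 2 := by positivity
    generalize u = v at *
    field_simp
  have hfin := tsum_of_norm_bounded (hmom.hasSum.mul_left _) hb
  rw [← hsum, Real.norm_eq_abs, abs_mul, abs_two] at hfin
  rw [abs_mul, abs_of_nonneg (by positivity : (0 : ℝ) ≤ (n : ℝ) ^ 2)]
  have h1 : 0 < 1 + u ^ 2 := by positivity
  calc (n : ℝ) ^ 2 * |∑' z, T z| = (n : ℝ) ^ 2 / 2 * (2 * |∑' z, T z|) := by ring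
    _ ≤ (n : ℝ) ^ 2 / 2 * (K / (n ^ 2 * (1 + u ^ 2)) * ∑' z : ℤ, (z : ℝ) ^ 2 * s z) :=
        mul_le_mul_of_nonneg_left hfin (by positivity)
    _ = _ := by
      clear_value u
      field_simp
end

section
/- Let s : ℤ → ℝ be a symmetric transition probability with finite second moment σ², and let f be a Schwartz function on ℝ. Then lim_{n→∞} (1/n) ∑_{x,y∈ℤ} s(y−x) ( n ( f(y/n) − f(x/n) ) )² = σ² ∫_ℝ (f'(u))² du. -/
open Filter MeasureTheory

lemma aux_mvt (f : SchwartzMap ℝ ℝ) (a b : ℝ) :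
    ∃ c, |c - a| ≤ |b - a| ∧ f b - f a = deriv (f : ℝ → ℝ) c * (b - a) := by
  have hd : Differentiable ℝ (f : ℝ → ℝ) := f.differentiable
  rcases lt_trichotomy a b with h | h | h
  · obtain ⟨c, hc, he⟩ := exists_deriv_eq_slope (f : ℝ → ℝ) h hd.continuous.continuousOn
      hd.differentiableOn
    refine ⟨c, ?_, ?_⟩
    · rw [abs_of_pos (by linarith [hc.1]), abs_of_pos (by linarith)]; linarith [hc.2]
    · rw [he]; field_simp [sub_ne_zero.2 h.ne']
  · subst h; exact ⟨a, by simp, by simp⟩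
  · obtain ⟨c, hc, he⟩ := exists_deriv_eq_slope (f : ℝ → ℝ) h hd.continuous.continuousOn
      hd.differentiableOn
    refine ⟨c, ?_, ?_⟩
    · rw [abs_of_neg (by linarith [hc.2]), abs_of_neg (by linarith)]; linarith [hc.1]
    · have : a - b ≠ 0 := sub_ne_zero.2 h.ne'
      rw [he]; field_simp; ring

lemma aux_decay (f : SchwartzMap ℝ ℝ) :
    ∃ C, 0 ≤ C ∧ ∀ v, |deriv (f : ℝ → ℝ) v| * (1 + v ^ 2) ≤ C := by
  obtain ⟨C0, h0, H0⟩ := (SchwartzMap.derivCLM ℝ ℝ f).decay 0 0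
  obtain ⟨C2, h2, H2⟩ := (SchwartzMap.derivCLM ℝ ℝ f).decay 2 0
  refine ⟨C0 + C2, by linarith, fun v => ?_⟩
  have a := H0 v
  have b := H2 v
  simp [SchwartzMap.derivCLM_apply] at a b
  nlinarith

lemma aux_cont (f : SchwartzMap ℝ ℝ) : Continuous (deriv (f : ℝ → ℝ)) := by
  have := (SchwartzMap.derivCLM ℝ ℝ f).continuous
  exact this

lemma aux_floor (h : ℤ → ℝ) (hi : Integrable (fun u : ℝ => h ⌊u⌋)) :
    HasSum h (∫ u : ℝ, h ⌊u⌋) := by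
  have := hasSum_integral_iUnion (μ := volume) (f := fun u : ℝ => h ⌊u⌋)
    (s := fun k : ℤ => Set.Ico (k : ℝ) (k + 1)) (fun k => measurableSet_Ico)
    (Set.pairwise_disjoint_Ico_intCast ℝ) hi.integrableOn
  rw [iUnion_Ico_intCast, setIntegral_univ] at this
  refine (congrArg (fun g => HasSum g (∫ u : ℝ, h ⌊u⌋)) ?_).mp this
  funext k
  rw [setIntegral_congr_fun (g := fun _ => h k) measurableSet_Ico]
  · simp
  · intro u hu
    have : ⌊u⌋ = k := Int.floor_eq_iff.2 hu
    simp [this]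

lemma aux_point (f : SchwartzMap ℝ ℝ) (n : ℕ) (hn : 1 ≤ n) (z : ℤ) (u : ℝ) :
    ∃ c, |c - u| ≤ (|(z:ℝ)| + 1) / n ∧
      (n : ℝ) * (f (((⌊n * u⌋ + z : ℤ) : ℝ) / n) - f ((⌊n * u⌋ : ℝ) / n))
        = z * deriv (f : ℝ → ℝ) c := by
  have hn' : (0:ℝ) < n := by exact_mod_cast hn
  obtain ⟨c, hc, he⟩ := aux_mvt f ((⌊n * u⌋ : ℝ) / n) (((⌊n * u⌋ + z : ℤ) : ℝ) / n)
  have hd : ((⌊n * u⌋ + z : ℤ) : ℝ) / n - (⌊n * u⌋ : ℝ) / n = z / n := by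
    push_cast; ring
  rw [hd] at hc he
  refine ⟨c, ?_, ?_⟩
  · have h1 : |(⌊n * u⌋ : ℝ) / n - u| ≤ 1 / n := by
      have : (⌊n * u⌋ : ℝ) / n - u = (⌊n * u⌋ - n * u) / n := by field_simp
      rw [this, abs_div, abs_of_pos hn']
      gcongr
      rw [abs_le]
      constructor <;> linarith [Int.floor_le (n * u), Int.lt_floor_add_one (n * u)]
    rw [abs_div, abs_of_pos hn'] at hc
    calc |c - u| ≤ |c - (⌊n * u⌋ : ℝ) / n| + |(⌊n * u⌋ : ℝ) / n - u| := abs_sub_le _ _ _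
      _ ≤ |(z:ℝ)| / n + 1 / n := add_le_add hc h1
      _ = _ := by ring
  · rw [he]; field_simp

lemma aux_dom (f : SchwartzMap ℝ ℝ) (z : ℤ) : ∃ K : ℝ, ∀ n : ℕ, 1 ≤ n → ∀ u : ℝ,
    ((n : ℝ) * (f (((⌊n * u⌋ + z : ℤ) : ℝ) / n) - f ((⌊n * u⌋ : ℝ) / n))) ^ 2
      ≤ K * (1 + u ^ 2)⁻¹ := by
  obtain ⟨C, hC, H⟩ := aux_decay f
  set R := |(z:ℝ)| + 1 with hR
  have hR0 : 0 ≤ R := by positivity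
  refine ⟨(z * (C * (2 * (1 + R ^ 2)))) ^ 2, fun n hn u => ?_⟩
  obtain ⟨c, hc, he⟩ := aux_point f n hn z u
  rw [he]
  have hn' : (1:ℝ) ≤ n := by exact_mod_cast hn
  have hc' : |c - u| ≤ R := hc.trans (div_le_self hR0 hn')
  have hsq : (c - u) ^ 2 ≤ R ^ 2 := by
    rw [← sq_abs]; gcongr
  have hu : 1 + u ^ 2 ≤ 2 * (1 + R ^ 2) * (1 + c ^ 2) := by
    nlinarith [sq_nonneg (2 * c - u), mul_nonneg (sq_nonneg R) (sq_nonneg c)]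
  have hb : |deriv (f : ℝ → ℝ) c| * (1 + u ^ 2) ≤ C * (2 * (1 + R ^ 2)) := by
    calc _ ≤ |deriv (f : ℝ → ℝ) c| * (2 * (1 + R ^ 2) * (1 + c ^ 2)) := by gcongr
      _ = (|deriv (f : ℝ → ℝ) c| * (1 + c ^ 2)) * (2 * (1 + R ^ 2)) := by ring
      _ ≤ _ := by gcongr; exact H c
  have hp : 0 < 1 + u ^ 2 := by positivity
  rw [mul_pow, mul_pow, mul_assoc]
  gcongr
  rw [← div_eq_mul_inv, le_div_iff₀ hp]
  calc deriv (f : ℝ → ℝ) c ^ 2 * (1 + u ^ 2)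
      ≤ deriv (f : ℝ → ℝ) c ^ 2 * (1 + u ^ 2) ^ 2 := by
        gcongr; nlinarith [sq_nonneg u]
    _ = (|deriv (f : ℝ → ℝ) c| * (1 + u ^ 2)) ^ 2 := by rw [mul_pow, sq_abs]
    _ ≤ _ := by gcongr

lemma aux_int (f : SchwartzMap ℝ ℝ) (z : ℤ) (n : ℕ) (hn : 1 ≤ n) : Integrable (fun u : ℝ =>
    ((n : ℝ) * (f (((⌊n * u⌋ + z : ℤ) : ℝ) / n) - f ((⌊n * u⌋ : ℝ) / n))) ^ 2) := by
  obtain ⟨K, hK⟩ := aux_dom f z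
  refine Integrable.mono' (integrable_inv_one_add_sq.const_mul K) ?_ ?_
  · have : Measurable (fun k : ℤ => ((n : ℝ) * (f (((k + z : ℤ) : ℝ) / n) - f ((k : ℝ) / n))) ^ 2) :=
      measurable_of_countable _
    exact (this.comp (Int.measurable_floor.comp (measurable_const_mul (n:ℝ)))).aestronglyMeasurable
  · refine Eventually.of_forall fun u => ?_
    rw [Real.norm_of_nonneg (sq_nonneg _)]
    exact hK n hn u

lemma aux_hasSum (f : SchwartzMap ℝ ℝ) (z : ℤ) (n : ℕ) (hn : 1 ≤ n) :
    HasSum (fun x : ℤ => ((n : ℝ) * (f (((x + z : ℤ) : ℝ) / n) - f ((x : ℝ) / n))) ^ 2)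
      (n * ∫ u : ℝ,
      ((n : ℝ) * (f (((⌊n * u⌋ + z : ℤ) : ℝ) / n) - f ((⌊n * u⌋ : ℝ) / n))) ^ 2) := by
  have hn' : (0:ℝ) < n := by exact_mod_cast hn
  set h : ℤ → ℝ := fun x => ((n : ℝ) * (f (((x + z : ℤ) : ℝ) / n) - f ((x : ℝ) / n))) ^ 2 with hh
  have hi : Integrable (fun u : ℝ => h ⌊(n:ℝ) * u⌋) := aux_int f z n hn
  have hi2 : Integrable (fun u : ℝ => h ⌊u⌋) :=
    (integrable_comp_mul_left_iff (fun u : ℝ => h ⌊u⌋) hn'.ne').1 hi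
  have e : (∫ u : ℝ, h ⌊(n:ℝ) * u⌋) = |(n:ℝ)⁻¹| • ∫ u : ℝ, h ⌊u⌋ :=
    Measure.integral_comp_mul_left (fun u : ℝ => h ⌊u⌋) n
  have := aux_floor h hi2
  convert this using 1
  change (n:ℝ) * (∫ u : ℝ, h ⌊(n:ℝ) * u⌋) = _
  rw [e, abs_of_pos (inv_pos.2 hn'), smul_eq_mul]
  field_simp

lemma aux_lim (f : SchwartzMap ℝ ℝ) (z : ℤ) :
    Tendsto (fun n : ℕ => ∫ u : ℝ,
      ((n : ℝ) * (f (((⌊n * u⌋ + z : ℤ) : ℝ) / n) - f ((⌊n * u⌋ : ℝ) / n))) ^ 2) atTop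
      (nhds ((z:ℝ) ^ 2 * ∫ u : ℝ, (deriv (f : ℝ → ℝ) u) ^ 2)) := by
  obtain ⟨K, hK⟩ := aux_dom f z
  rw [← integral_const_mul]
  refine tendsto_integral_filter_of_dominated_convergence (fun u => K * (1 + u ^ 2)⁻¹) ?_ ?_
    (integrable_inv_one_add_sq.const_mul K) ?_
  · filter_upwards [eventually_ge_atTop 1] with n hn
    exact (aux_int f z n hn).aestronglyMeasurable
  · filter_upwards [eventually_ge_atTop 1] with n hn
    refine Eventually.of_forall fun u => ?_
    rw [Real.norm_of_nonneg (sq_nonneg _)]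
    exact hK n hn u
  · refine Eventually.of_forall fun u => ?_
    have hex : ∀ n : ℕ, ∃ c, 1 ≤ n → |c - u| ≤ (|(z:ℝ)| + 1) / n ∧
      (n : ℝ) * (f (((⌊n * u⌋ + z : ℤ) : ℝ) / n) - f ((⌊n * u⌋ : ℝ) / n))
        = z * deriv (f : ℝ → ℝ) c := by
      intro n
      by_cases hn : 1 ≤ n
      · obtain ⟨c, hc⟩ := aux_point f n hn z u
        exact ⟨c, fun _ => hc⟩
      · exact ⟨0, fun h => absurd h hn⟩
    choose c hc using hex
    have hcu : Tendsto c atTop (nhds u) := by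
      rw [tendsto_iff_norm_sub_tendsto_zero]
      refine squeeze_zero' (Eventually.of_forall fun _ => norm_nonneg _) ?_
        (tendsto_const_div_atTop_nhds_zero_nat (|(z:ℝ)| + 1))
      filter_upwards [eventually_ge_atTop 1] with n hn
      exact (hc n hn).1
    have h2 := ((((aux_cont f).tendsto u).comp hcu).pow 2).const_mul ((z:ℝ) ^ 2)
    refine h2.congr' ?_
    filter_upwards [eventually_ge_atTop 1] with n hn
    rw [(hc n hn).2, mul_pow]; rfl

lemma aux_tele_nat (F : ℤ → ℝ) (h1 : Summable fun x => (F (x + 1) - F x) ^ 2) (m : ℕ)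
    (hm : Summable fun x => (F (x + m) - F x) ^ 2) :
    ∑' x, (F (x + m) - F x) ^ 2 ≤ (m:ℝ) ^ 2 * ∑' x, (F (x + 1) - F x) ^ 2 := by
  have hk : ∀ k : ℕ, HasSum (fun x : ℤ => (F (x + k + 1) - F (x + k)) ^ 2)
      (∑' x, (F (x + 1) - F x) ^ 2) := fun k =>
    (Equiv.addRight (k : ℤ)).hasSum_iff (f := fun x => (F (x + 1) - F x) ^ 2) |>.2 h1.hasSum
  have hs := (hasSum_sum (s := Finset.range m) (fun k _ => hk k)).mul_left (m:ℝ)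
  have := hasSum_le (fun x => ?_) hm.hasSum hs
  · refine this.trans (le_of_eq ?_)
    simp; ring
  · have ht : F (x + m) - F x = ∑ k ∈ Finset.range m, (F (x + k + 1) - F (x + k)) := by
      have := Finset.sum_range_sub (fun k : ℕ => F (x + k)) m
      simp only [Nat.cast_add, Nat.cast_one, Nat.cast_zero, add_zero, ← add_assoc] at this
      rw [this]
    rw [ht]
    simpa using sq_sum_le_card_mul_sum_sq (s := Finset.range m)
      (f := fun k : ℕ => F (x + k + 1) - F (x + k))

lemma aux_tele (F : ℤ → ℝ) (h : ∀ z : ℤ, Summable fun x => (F (x + z) - F x) ^ 2) (z : ℤ) :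
    ∑' x, (F (x + z) - F x) ^ 2 ≤ (z:ℝ) ^ 2 * ∑' x, (F (x + 1) - F x) ^ 2 := by
  obtain ⟨m, rfl | rfl⟩ := z.eq_nat_or_neg
  · simpa using aux_tele_nat F (h 1) m (h m)
  · have := aux_tele_nat F (h 1) m (h m)
    have e : ∑' x, (F (x + -(m:ℤ)) - F x) ^ 2 = ∑' x, (F (x + m) - F x) ^ 2 := by
      rw [← (Equiv.addRight (m : ℤ)).tsum_eq]
      refine tsum_congr fun x => ?_
      simp only [Equiv.coe_addRight, add_neg_cancel_right]
      ring
    rw [e]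
    simpa using this

/-- Lemma A.2: `lim_{n→∞} (1/n) ∑_{x,y∈ℤ} s(y−x) (∇ⁿ_{x,y} f)² = σ² ∫ (f')²`,
where `∇ⁿ_{x,y} f = n (f(y/n) − f(x/n))`. -/
theorem stmt_3 (s : ℤ → ℝ) (hpos : ∀ z, 0 ≤ s z) (hsym : ∀ z, s (-z) = s z)
    (hzero : s 0 = 0) (hprob : HasSum s 1)
    (hmom : Summable fun z : ℤ => (z : ℝ) ^ 2 * s z)
    (σ2 : ℝ) (hσ2 : σ2 = ∑' z : ℤ, (z : ℝ) ^ 2 * s z)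
    (f : SchwartzMap ℝ ℝ) :
    Tendsto (fun n : ℕ => (1 / (n : ℝ)) * ∑' x : ℤ, ∑' y : ℤ,
        s (y - x) * ((n : ℝ) * (f ((y : ℝ) / n) - f ((x : ℝ) / n))) ^ 2)
      atTop (nhds (σ2 * ∫ u : ℝ, (deriv (f : ℝ → ℝ) u) ^ 2)) := by
  set A : ℕ → ℤ → ℝ := fun n z => ∫ u : ℝ,
      ((n : ℝ) * (f (((⌊n * u⌋ + z : ℤ) : ℝ) / n) - f ((⌊n * u⌋ : ℝ) / n))) ^ 2 with hA
  set I := ∫ u : ℝ, (deriv (f : ℝ → ℝ) u) ^ 2 with hI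
  have hA0 : ∀ n z, 0 ≤ A n z := fun n z => integral_nonneg fun u => sq_nonneg _
  have hsum : ∀ n : ℕ, 1 ≤ n → ∀ z, HasSum
      (fun x : ℤ => ((n : ℝ) * (f (((x + z : ℤ) : ℝ) / n) - f ((x : ℝ) / n))) ^ 2)
      (n * A n z) := fun n hn z => aux_hasSum f z n hn
  have hbd : ∀ n : ℕ, 1 ≤ n → ∀ z, A n z ≤ (z:ℝ) ^ 2 * A n 1 := by
    intro n hn z
    have hn' : (0:ℝ) < n := by exact_mod_cast hn
    have := aux_tele (fun x : ℤ => (n:ℝ) * f ((x:ℝ) / n))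
      (fun w => by simpa only [mul_sub] using (hsum n hn w).summable) z
    have e : ∀ w, ∑' x : ℤ, ((n:ℝ) * f (((x + w : ℤ):ℝ) / n) - (n:ℝ) * f ((x:ℝ) / n)) ^ 2
        = n * A n w := fun w => by simpa only [mul_sub] using (hsum n hn w).tsum_eq
    rw [e z, e 1] at this
    refine le_of_mul_le_mul_left ?_ hn'
    linarith
  have key : ∀ n : ℕ, 1 ≤ n → (1 / (n : ℝ)) * ∑' x : ℤ, ∑' y : ℤ,
        s (y - x) * ((n : ℝ) * (f ((y : ℝ) / n) - f ((x : ℝ) / n))) ^ 2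
        = ∑' z, s z * A n z := by
    intro n hn
    have hn' : (0:ℝ) < n := by exact_mod_cast hn
    set G : ℤ → ℤ → ℝ := fun z x =>
      s z * ((n : ℝ) * (f (((x + z : ℤ) : ℝ) / n) - f ((x : ℝ) / n))) ^ 2 with hG
    have hGs : ∀ z, HasSum (G z) (s z * (n * A n z)) := fun z => (hsum n hn z).mul_left _
    have hre : ∀ x : ℤ, ∑' y : ℤ,
        s (y - x) * ((n : ℝ) * (f ((y : ℝ) / n) - f ((x : ℝ) / n))) ^ 2 = ∑' z, G z x := by
      intro x
      rw [← (Equiv.addLeft x).tsum_eq]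
      refine tsum_congr fun z => ?_
      simp [hG]
    have hprod : Summable (Function.uncurry G) := by
      rw [summable_prod_of_nonneg]
      · refine ⟨fun z => (hGs z).summable, ?_⟩
        simp only [Function.uncurry_apply_pair, (hGs _).tsum_eq]
        refine Summable.of_nonneg_of_le (fun z => ?_) (fun z => ?_) (hmom.mul_right (n * A n 1))
        · have := hpos z; have := hA0 n z; positivity
        · calc s z * (n * A n z) ≤ s z * (n * ((z:ℝ) ^ 2 * A n 1)) := by
                have := hpos z; gcongr; exact hbd n hn z
            _ = _ := by ring
      · rintro ⟨z, x⟩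
        have := hpos z
        simp only [hG, Function.uncurry_apply_pair, Pi.zero_apply]
        positivity
    simp_rw [hre]
    rw [hprod.tsum_comm]
    simp only [(hGs _).tsum_eq]
    rw [← tsum_mul_left]
    refine tsum_congr fun z => ?_
    field_simp
  have hlimA : ∀ z, Tendsto (fun n => A n z) atTop (nhds ((z:ℝ) ^ 2 * I)) := fun z => aux_lim f z
  have hlim : Tendsto (fun n => ∑' z, s z * A n z) atTop
      (nhds (∑' z : ℤ, s z * ((z:ℝ) ^ 2 * I))) := by
    refine tendsto_tsum_of_dominated_convergence (bound := fun z : ℤ => (z:ℝ) ^ 2 * s z * (I + 1))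
      (hmom.mul_right _) (fun z => (hlimA z).const_mul _) ?_
    have h1 : ∀ᶠ n in atTop, A n 1 < I + 1 := by
      have := hlimA 1
      simp only [Int.cast_one, one_pow, one_mul] at this
      exact this.eventually_lt_const (by linarith)
    filter_upwards [h1, eventually_ge_atTop 1] with n hn1 hn z
    rw [Real.norm_of_nonneg (mul_nonneg (hpos z) (hA0 n z))]
    calc s z * A n z ≤ s z * ((z:ℝ) ^ 2 * (I + 1)) := by
          have := hpos z
          gcongr
          exact (hbd n hn z).trans (by gcongr)
      _ = _ := by ring
  have hfin : ∑' z : ℤ, s z * ((z:ℝ) ^ 2 * I) = σ2 * I := by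
    rw [hσ2, ← tsum_mul_right]
    exact tsum_congr fun z => by ring
  rw [← hfin]
  refine hlim.congr' ?_
  filter_upwards [eventually_ge_atTop 1] with n hn
  exact (key n hn).symm
end

section
/- (Moving-particle lemma.) Let μ_{1/2} be the Bernoulli product measure of density 1/2 on Ω = {0,1}^ℤ and let h ∈ L²(μ_{1/2}). Then for every x ∈ ℤ and every integer z ≥ 1, I_{x,x+z}(h) ≤ (4z − 3) ∑_{y=x}^{x+z−1} I_{y,y+1}(h). -/
open MeasureTheory

/-- The configuration obtained from `η` by exchanging the values at `x` and `y`. -/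
def swapConf (x y : ℤ) (η : ℤ → Bool) : ℤ → Bool :=
  fun w => if w = x then η y else if w = y then η x else η w

/-- `I_{x,y}(h) = ∫ (h(η^{x,y}) − h(η))² dμ`. -/
noncomputable def Ixy (μ : Measure (ℤ → Bool)) (h : (ℤ → Bool) → ℝ) (x y : ℤ) : ℝ :=
  ∫ η, (h (swapConf x y η) - h η) ^ 2 ∂μ

theorem swapConf_eq (x y : ℤ) (η : ℤ → Bool) (w : ℤ) :
    swapConf x y η w = η (Equiv.swap x y w) := by
  unfold swapConf
  rw [Equiv.swap_apply_def]
  split_ifs <;> rfl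

theorem swapConf_measurable (x y : ℤ) : Measurable (swapConf x y) := by
  rw [measurable_pi_iff]
  intro w
  simp only [swapConf_eq]
  exact measurable_pi_apply _

theorem swapConf_mp (μ : Measure (ℤ → Bool)) [IsProbabilityMeasure μ]
    (hμ : ∀ (S : Finset ℤ) (b : ℤ → Bool),
      μ {η | ∀ x ∈ S, η x = b x} = (1 / 2 : ENNReal) ^ S.card) (x y : ℤ) :
    MeasurePreserving (swapConf x y) μ μ := by
  refine ⟨swapConf_measurable x y, ?_⟩
  have hm := swapConf_measurable x y
  have : IsProbabilityMeasure (μ.map (swapConf x y)) :=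
    Measure.isProbabilityMeasure_map hm.aemeasurable
  have h1 : IsProjectiveLimit μ (fun I : Finset ℤ => μ.map I.restrict) := fun I => rfl
  refine IsProjectiveLimit.unique (P := fun I : Finset ℤ => μ.map I.restrict) ?_ h1
  intro I
  refine Measure.ext_of_singleton fun b => ?_
  have hr : Measurable (I.restrict (π := fun _ : ℤ => Bool)) := Finset.measurable_restrict I
  rw [Measure.map_apply hr (measurableSet_singleton b),
    Measure.map_apply hm (hr (measurableSet_singleton b)),
    Measure.map_apply hr (measurableSet_singleton b)]
  let b' : ℤ → Bool := fun w => if hw : w ∈ I then b ⟨w, hw⟩ else false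
  have e1 : I.restrict (π := fun _ : ℤ => Bool) ⁻¹' {b} = {η : ℤ → Bool | ∀ w ∈ I, η w = b' w} := by
    ext η
    simp only [Set.mem_preimage, Set.mem_singleton_iff, Set.mem_ofPred_eq, funext_iff,
      Subtype.forall, Finset.restrict, b']
    refine forall_congr' fun w => forall_congr' fun hw => ?_
    simp [hw]
  have e2 : swapConf x y ⁻¹' {η : ℤ → Bool | ∀ w ∈ I, η w = b' w} =
      {η | ∀ w ∈ I.image (Equiv.swap x y), η w = b' (Equiv.swap x y w)} := by
    ext η
    simp [swapConf_eq]
  rw [e1, e2, hμ I b', hμ (I.image (Equiv.swap x y)) (fun w => b' (Equiv.swap x y w)),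
    Finset.card_image_of_injective _ (Equiv.injective _)]

theorem swapConf_comp (x y w : ℤ) (h1 : x ≠ y) (h2 : x ≠ w) (η : ℤ → Bool) :
    swapConf x w η = swapConf y w (swapConf x y (swapConf y w η)) := by
  funext v
  unfold swapConf
  grind

theorem stmt_5 (μ : Measure (ℤ → Bool)) [IsProbabilityMeasure μ]
    (hμ : ∀ (S : Finset ℤ) (b : ℤ → Bool),
      μ {η | ∀ x ∈ S, η x = b x} = (1 / 2 : ENNReal) ^ S.card)
    (h : (ℤ → Bool) → ℝ) (hh : MemLp h 2 μ)
    (x : ℤ) (z : ℕ) (hz : 1 ≤ z) :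
    Ixy μ h x (x + z) ≤ (4 * (z : ℝ) - 3) *
      ∑ k ∈ Finset.range z, Ixy μ h (x + k) (x + k + 1) := by
  have mp := swapConf_mp μ hμ
  have hD : ∀ a b, MemLp (fun η => h (swapConf a b η) - h η) 2 μ := fun a b =>
    (hh.comp_measurePreserving (mp a b)).sub hh
  induction z, hz using Nat.le_induction with
  | base => norm_num
  | succ z hz ih =>
    rw [Finset.sum_range_succ]
    set S := ∑ k ∈ Finset.range z, Ixy μ h (x + k) (x + k + 1)
    have hz' : (1 : ℝ) ≤ z := by exact_mod_cast hz
    set c : ℝ := 4 * (z : ℝ) - 3 with hc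
    have hc0 : 0 < c := by linarith
    let y : ℤ := x + z
    let g : (ℤ → Bool) → ℝ := fun η => h (swapConf y (y + 1) η) - h η
    let f : (ℤ → Bool) → ℝ := fun η => h (swapConf x y η) - h η
    let s := swapConf y (y + 1)
    let t := swapConf x y
    have hg : MemLp g 2 μ := hD _ _
    have hf : MemLp f 2 μ := hD _ _
    have mpst : MeasurePreserving (fun η => t (s η)) μ μ := (mp x y).comp (mp y (y + 1))
    have ig : Integrable (fun η => g η ^ 2) μ := hg.integrable_sq
    have igs : Integrable (fun η => g (t (s η)) ^ 2) μ :=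
      (hg.comp_measurePreserving mpst).integrable_sq
    have ifs : Integrable (fun η => f (s η) ^ 2) μ :=
      (hf.comp_measurePreserving (mp y (y + 1))).integrable_sq
    have key : ∀ φ : (ℤ → Bool) → ℝ, MemLp φ 2 μ → ∀ r : (ℤ → Bool) → (ℤ → Bool),
        MeasurePreserving r μ μ → ∫ η, φ (r η) ^ 2 ∂μ = ∫ η, φ η ^ 2 ∂μ := by
      intro φ hφ r hr
      have := integral_map (μ := μ) hr.measurable.aemeasurable (f := fun η => φ η ^ 2)
        (by rw [hr.map_eq]; exact hφ.integrable_sq.aestronglyMeasurable)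
      rw [hr.map_eq] at this
      exact this.symm
    have pt : ∀ η, (h (swapConf x (y + 1) η) - h η) ^ 2 ≤
        (4 + c) * ((g (t (s η)) ^ 2 + g η ^ 2) / 2 + f (s η) ^ 2 / c) := by
      intro η
      have e : h (swapConf x (y + 1) η) - h η = g (t (s η)) + f (s η) + g η := by
        rw [swapConf_comp x y (y + 1) (by simp only [y]; omega) (by simp only [y]; omega)]
        simp only [g, f, s, t]; ring
      rw [e]
      generalize g (t (s η)) = u
      generalize f (s η) = v
      generalize g η = w
      have : (4 + c) * ((u ^ 2 + w ^ 2) / 2 + v ^ 2 / c) - (u + v + w) ^ 2 =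
          ((c * (u + w) - 4 * v) ^ 2 / (4 * c)) + (4 + c) * (u - w) ^ 2 / 4 := by
        field_simp; ring
      have h2 : 0 ≤ ((c * (u + w) - 4 * v) ^ 2 / (4 * c)) + (4 + c) * (u - w) ^ 2 / 4 := by
        positivity
      linarith
    have igg : Integrable (fun η => (g (t (s η)) ^ 2 + g η ^ 2) / 2) μ :=
      (igs.add ig).div_const 2
    have hint := integral_mono (μ := μ) (hD x (y + 1)).integrable_sq
      ((igg.add (ifs.div_const c)).const_mul (4 + c)) pt
    simp only [Pi.add_apply] at hint
    rw [integral_const_mul, integral_add igg (ifs.div_const c)] at hint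
    rw [integral_div, integral_div,
      integral_add igs ig, key g hg _ mpst, key f hf s (mp y (y + 1))] at hint
    have eA : ∫ η, g η ^ 2 ∂μ = Ixy μ h (x + z) (x + z + 1) := rfl
    have eB : ∫ η, f η ^ 2 ∂μ = Ixy μ h x (x + z) := rfl
    have eC : Ixy μ h x (x + ((z + 1 : ℕ) : ℤ)) =
        ∫ η, (h (swapConf x (y + 1) η) - h η) ^ 2 ∂μ := by
      unfold Ixy; simp only [y]; push_cast; rw [add_assoc]
    rw [eA, eB] at hint
    rw [eC]
    have hdiv : Ixy μ h x (x + z) / c ≤ S := by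
      rw [div_le_iff₀ hc0]; linarith
    have h4 : (4 * (((z + 1 : ℕ) : ℝ)) - 3) = 4 + c := by rw [hc]; push_cast; ring
    rw [h4]
    refine hint.trans ?_
    apply mul_le_mul_of_nonneg_left _ (by linarith)
    linarith
end

section
/- Let s : ℤ → ℝ be a symmetric transition probability with finite second moment, let a : ℤ → ℝ be antisymmetric with |a(z)| ≤ C s(z) for all z and some finite constant C, and let f be a Schwartz function on ℝ. Then sup_{n≥1} (1/n) ∑_{x∈ℤ} ∑_{z>0} |a(z)| ( n ( f((x+z)/n) − f(x/n) ) )² < ∞. -/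
open Filter

open MeasureTheory in
lemma aux_cs (u : ℝ → ℝ) (hu : Continuous u) (x m : ℝ) (hm : 0 < m) :
    (∫ t in x..(x+m), u t)^2 ≤ m * ∫ t in x..(x+m), (u t)^2 := by
  set J := ∫ t in x..(x+m), u t with hJ
  have h0 : 0 ≤ ∫ t in x..(x+m), (u t - J/m)^2 :=
    intervalIntegral.integral_nonneg (by linarith) (fun t _ => sq_nonneg _)
  have h1 : ∫ t in x..(x+m), (u t - J/m)^2
      = (∫ t in x..(x+m), (u t)^2) - (2*(J/m)) * J + m * (J/m)^2 := by
    have : ∀ t, (u t - J/m)^2 = (u t)^2 - (2*(J/m)) * u t + (J/m)^2 := fun t => by ring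
    simp_rw [this]
    rw [intervalIntegral.integral_add, intervalIntegral.integral_sub,
      intervalIntegral.integral_const_mul, intervalIntegral.integral_const]
    · simp [hJ]
    all_goals apply Continuous.intervalIntegrable; fun_prop
  rw [h1] at h0
  have h2 : m * ((∫ t in x..(x+m), (u t)^2) - (2*(J/m)) * J + m * (J/m)^2)
      = m * (∫ t in x..(x+m), (u t)^2) - J^2 := by
    field_simp; ring
  have := mul_nonneg hm.le h0
  rw [h2] at this
  linarith

open MeasureTheory in
lemma aux_hasSum_s12 (h : ℝ → ℝ) (hi : Integrable h) (m : ℕ) :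
    HasSum (fun x : ℤ => ∫ t in (x:ℝ)..((x:ℝ)+m), h t) (m * ∫ t, h t) := by
  induction m with
  | zero => simpa using (hasSum_zero : HasSum (fun _ : ℤ => (0:ℝ)) 0)
  | succ k ih =>
    have := ih.add (hi.hasSum_intervalIntegral (k:ℝ))
    convert this using 1
    · funext x
      rw [add_comm (k:ℝ) x, intervalIntegral.integral_add_adjacent_intervals
        hi.intervalIntegrable hi.intervalIntegrable]
      push_cast; ring_nf
    · push_cast; ring

open MeasureTheory in
/-- Uniform bound: `sup_{n≥1} (1/n) ∑_{x∈ℤ} ∑_{z>0} |a(z)| (∇ⁿ_{x,x+z} f)² < ∞`, where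
`∇ⁿ_{x,x+z} f = n (f((x+z)/n) − f(x/n))`. -/
theorem stmt_12 (s a : ℤ → ℝ) (hpos : ∀ z, 0 ≤ s z) (hsym : ∀ z, s (-z) = s z)
    (hzero : s 0 = 0) (hprob : HasSum s 1)
    (hmom : Summable fun z : ℤ => (z : ℝ) ^ 2 * s z)
    (hanti : ∀ z, a (-z) = -a z)
    (C : ℝ) (hC : ∀ z, |a z| ≤ C * s z)
    (f : SchwartzMap ℝ ℝ) :
    ∃ K : ℝ, ∀ n : ℕ, 1 ≤ n →
      (1 / (n : ℝ)) * ∑' x : ℤ, ∑' z : ℕ, |a ((z : ℤ) + 1)| *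
          ((n : ℝ) * (f (((x : ℝ) + ((z : ℝ) + 1)) / n) - f ((x : ℝ) / n))) ^ 2 ≤ K := by
  set f' : SchwartzMap ℝ ℝ := SchwartzMap.derivCLM ℝ ℝ f with hf'
  have hd : ∀ x, HasDerivAt f (f' x) x := fun x => by
    rw [hf', SchwartzMap.derivCLM_apply]
    exact f.differentiableAt.hasDerivAt
  have hint : Integrable (fun t => (f' t)^2) := (f'.memLp 2 volume).integrable_sq
  have hmom' : Summable fun z : ℕ => C * s ((z:ℤ)+1) * ((z:ℝ)+1)^2 := by
    have := (hmom.comp_injective (i := fun z : ℕ => (z:ℤ)+1)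
      (fun x y h => by simpa using h)).mul_left C
    refine this.congr fun z => ?_
    simp only [Function.comp]; push_cast; ring
  refine ⟨(∑' z : ℕ, C * s ((z:ℤ)+1) * ((z:ℝ)+1)^2) * ∫ t, (f' t)^2, fun n hn => ?_⟩
  have hn0 : (0:ℝ) < n := by exact_mod_cast hn
  set h : ℝ → ℝ := fun t => (f' (t / n))^2 with hh
  have hhi : Integrable h := hint.comp_div hn0.ne'
  have hhI : ∫ t, h t = n * ∫ t, (f' t)^2 := by
    have := Measure.integral_comp_div (fun t => (f' t)^2) (n:ℝ)
    simpa [hh, abs_of_pos hn0] using this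
  have hcont : Continuous fun t : ℝ => f' (t / n) := f'.continuous.comp (by fun_prop)
  have key : ∀ (x : ℤ) (z : ℕ),
      ((n : ℝ) * (f (((x : ℝ) + ((z : ℝ) + 1)) / n) - f ((x : ℝ) / n))) ^ 2
        ≤ ((z:ℝ)+1) * ∫ t in (x:ℝ)..((x:ℝ)+((z+1 : ℕ):ℝ)), h t := by
    intro x z
    have e : ∫ t in (x:ℝ)..((x:ℝ)+((z:ℝ)+1)), f' (t / n)
        = (n : ℝ) * (f (((x : ℝ) + ((z : ℝ) + 1)) / n) - f ((x : ℝ) / n)) := by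
      rw [mul_sub]
      refine intervalIntegral.integral_eq_sub_of_hasDerivAt
        (f := fun t => (n:ℝ) * f (t / n)) (fun t _ => ?_) (hcont.intervalIntegrable _ _)
      have := (((hd (t/n)).comp t ((hasDerivAt_id t).div_const (n:ℝ)))).const_mul (n:ℝ)
      have e2 : (n:ℝ) * (f' (t / n) * (1 / n)) = f' (t / n) := by field_simp
      rw [← e2]
      exact this
    rw [← e]
    push_cast
    exact aux_cs _ hcont _ _ (by positivity)
  set F : ℕ → ℤ → ℝ := fun z x => |a ((z : ℤ) + 1)| *
          ((n : ℝ) * (f (((x : ℝ) + ((z : ℝ) + 1)) / n) - f ((x : ℝ) / n))) ^ 2 with hF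
  set B : ℕ → ℤ → ℝ := fun z x => C * s ((z:ℤ)+1) *
    (((z:ℝ)+1) * ∫ t in (x:ℝ)..((x:ℝ)+((z+1 : ℕ):ℝ)), h t) with hB
  have hF0 : ∀ z x, 0 ≤ F z x := fun z x => by positivity
  have hFB : ∀ z x, F z x ≤ B z x := fun z x =>
    mul_le_mul (hC _) (key x z) (sq_nonneg _) ((abs_nonneg _).trans (hC _))
  have hBs : ∀ z, HasSum (B z) (C * s ((z:ℤ)+1) * ((z:ℝ)+1)^2 * ∫ t, h t) := fun z => by
    have := ((aux_hasSum_s12 h hhi (z+1)).mul_left ((z:ℝ)+1)).mul_left (C * s ((z:ℤ)+1))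
    have e3 : C * s ((z:ℤ)+1) * ((z:ℝ)+1)^2 * ∫ t, h t
        = C * s ((z:ℤ)+1) * (((z:ℝ)+1) * (((z+1 : ℕ):ℝ) * ∫ t, h t)) := by
      push_cast; ring
    rw [e3]
    exact this
  have hFs : ∀ z, Summable (F z) := fun z =>
    Summable.of_nonneg_of_le (hF0 z) (hFB z) (hBs z).summable
  have hFt : ∀ z, ∑' x, F z x ≤ C * s ((z:ℤ)+1) * ((z:ℝ)+1)^2 * ∫ t, h t := fun z =>
    (Summable.tsum_le_tsum (hFB z) (hFs z) (hBs z).summable).trans_eq (hBs z).tsum_eq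
  have hm2 := hmom'.mul_right (∫ t, h t)
  have hFt2 : Summable fun z => ∑' x, F z x :=
    Summable.of_nonneg_of_le (fun z => tsum_nonneg (hF0 z)) hFt hm2
  have hprod : Summable (Function.uncurry F) :=
    (summable_prod_of_nonneg (fun p => hF0 p.1 p.2)).2 ⟨hFs, hFt2⟩
  have hcomm : ∑' x : ℤ, ∑' z : ℕ, F z x = ∑' z : ℕ, ∑' x : ℤ, F z x := hprod.tsum_comm
  change (1 / (n:ℝ)) * ∑' x : ℤ, ∑' z : ℕ, F z x ≤ _
  rw [hcomm]
  have hle := Summable.tsum_le_tsum hFt hFt2 hm2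
  rw [tsum_mul_right, hhI] at hle
  rw [one_div, inv_mul_le_iff₀ hn0]
  linarith
end

section
/- Let s : ℤ → ℝ be a symmetric transition probability with finite second moment and let f be a Schwartz function on ℝ. Then there exists a finite constant c(f) such that for every n ≥ 1, (1/n²) ∑_{x,y∈ℤ} s(y−x)² ( n ( f(y/n) − f(x/n) ) )⁴ ≤ c(f)/n. -/
open Filter

lemma aux_deriv_s13 (f : SchwartzMap ℝ ℝ) :
    ∃ K : ℝ, 0 ≤ K ∧ ∀ u : ℝ, (deriv f u) ^ 4 ≤ K / (1 + u ^ 2) := by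
  obtain ⟨C0, h0p, h0⟩ := (SchwartzMap.derivCLM ℝ ℝ f).decay 0 0
  obtain ⟨C2, h2p, h2⟩ := (SchwartzMap.derivCLM ℝ ℝ f).decay 2 0
  refine ⟨C0 ^ 3 * (C0 + C2), by positivity, fun u => ?_⟩
  have a0 := h0 u
  have a2 := h2 u
  simp only [norm_iteratedFDeriv_zero, SchwartzMap.derivCLM_apply, pow_zero, one_mul,
    Real.norm_eq_abs, sq_abs] at a0 a2
  rw [le_div_iff₀ (by positivity)]
  have e : (deriv f u) ^ 4 = |deriv f u| ^ 4 := by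
    rw [← abs_pow, abs_of_nonneg (by positivity)]
  rw [e]
  have h3 : |deriv f u| ^ 3 ≤ C0 ^ 3 := by gcongr
  calc |deriv f u| ^ 4 * (1 + u ^ 2)
      = |deriv f u| ^ 3 * (|deriv f u| + u ^ 2 * |deriv f u|) := by ring
    _ ≤ _ := by gcongr

lemma aux_step (f : SchwartzMap ℝ ℝ) (K : ℝ) (hK : 0 ≤ K)
    (h : ∀ u : ℝ, (deriv f u) ^ 4 ≤ K / (1 + u ^ 2)) (n : ℕ) (hn : 1 ≤ n) (x : ℤ) :
    ((n : ℝ) * f (((x + 1 : ℤ) : ℝ) / n) - (n : ℝ) * f ((x : ℝ) / n)) ^ 4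
      ≤ 3 * K * (1 / (1 + (((x / (n : ℤ) : ℤ)) : ℝ) ^ 2)) := by
  have hn0 : (0 : ℝ) < n := by exact_mod_cast hn
  have hlt : (x : ℝ) / n < ((x + 1 : ℤ) : ℝ) / n := by
    push_cast; gcongr; linarith
  obtain ⟨u, hu, e⟩ := exists_deriv_eq_slope f hlt f.continuous.continuousOn
    f.differentiable.differentiableOn
  have e2 : (n : ℝ) * f (((x + 1 : ℤ) : ℝ) / n) - (n : ℝ) * f ((x : ℝ) / n) = deriv f u := by
    rw [e]; push_cast; field_simp; ring
  rw [e2]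
  refine (h u).trans ?_
  set q : ℤ := x / (n : ℤ) with hq
  have hnz : (0 : ℤ) < n := by exact_mod_cast hn
  have q1 : (q : ℝ) ≤ u := by
    have : q * n ≤ x := Int.ediv_mul_le x hnz.ne'
    have t : (q : ℝ) * n ≤ x := by exact_mod_cast this
    exact ((le_div_iff₀ hn0).2 t).trans hu.1.le
  have q2 : u ≤ q + 1 := by
    have : x + 1 ≤ (q + 1) * n := Int.lt_ediv_add_one_mul_self x hnz
    have t : ((x + 1 : ℤ) : ℝ) ≤ ((q : ℝ) + 1) * n := by exact_mod_cast this
    exact hu.2.le.trans ((div_le_iff₀ hn0).2 t)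
  rw [mul_one_div, div_le_div_iff₀ (by positivity) (by positivity)]
  have : 1 + (q : ℝ) ^ 2 ≤ 3 * (1 + u ^ 2) := by nlinarith [sq_nonneg (u + (u - q))]
  nlinarith [mul_le_mul_of_nonneg_left this hK]

lemma aux_div (g : ℤ → ℝ) (hg : Summable g) (n : ℕ) (hn : 1 ≤ n) :
    HasSum (fun x : ℤ => g (x / (n : ℤ))) (n * ∑' q, g q) := by
  have : NeZero n := ⟨by omega⟩
  have h1 : HasSum (fun p : ℤ × Fin n => g p.1) (n * ∑' q, g q) := by
    have hs : ∀ q : ℤ, HasSum (fun _ : Fin n => g q) (n * g q) := fun q => by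
      simpa using hasSum_fintype (fun _ : Fin n => g q)
    have hsum : Summable (fun p : ℤ × Fin n => g p.1) := by
      have := hg.abs.mul_of_nonneg (g := fun _ : Fin n => (1 : ℝ)) (hasSum_fintype _).summable
        (fun _ => abs_nonneg _) (fun _ => zero_le_one)
      exact (this.congr (fun p => by simp)).of_abs
    have := hsum.hasSum.prod_fiberwise (fun q => hs q)
    have e := this.unique (hg.hasSum.mul_left (n : ℝ))
    rw [← e]; exact hsum.hasSum
  exact ((Int.divModEquiv n).hasSum_iff (f := fun p : ℤ × Fin n => g p.1)).2 h1

lemma aux_nat (F : ℤ → ℝ) (hF : Summable fun x => (F (x + 1) - F x) ^ 4) (k : ℕ) :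
    Summable (fun x => (F (x + k) - F x) ^ 4) ∧
    ∑' x, (F (x + k) - F x) ^ 4 ≤ (k : ℝ) ^ 4 * ∑' x, (F (x + 1) - F x) ^ 4 := by
  set b : ℤ → ℝ := fun x => F (x + 1) - F x with hb
  have hs : ∀ i : ℕ, HasSum (fun x : ℤ => b (x + i) ^ 4) (∑' x, b x ^ 4) := fun i =>
    ((Equiv.addRight (i : ℤ)).hasSum_iff (f := fun x => b x ^ 4)).2 hF.hasSum
  have hS : HasSum (fun x : ℤ => (k : ℝ) ^ 3 * ∑ i ∈ Finset.range k, b (x + i) ^ 4)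
      ((k : ℝ) ^ 4 * ∑' x, b x ^ 4) := by
    have := (hasSum_sum (s := Finset.range k) (fun i _ => hs i)).mul_left ((k : ℝ) ^ 3)
    have e : (k : ℝ) ^ 3 * ∑ _i ∈ Finset.range k, ∑' x, b x ^ 4 = (k : ℝ) ^ 4 * ∑' x, b x ^ 4 := by
      rw [Finset.sum_const, Finset.card_range, nsmul_eq_mul]; ring
    rw [← e]; exact this
  have hle : ∀ x, (F (x + k) - F x) ^ 4 ≤ (k : ℝ) ^ 3 * ∑ i ∈ Finset.range k, b (x + i) ^ 4 := by
    intro x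
    have e : F (x + k) - F x = ∑ i ∈ Finset.range k, b (x + i) := by
      have := Finset.sum_range_sub (fun i : ℕ => F (x + i)) k
      simp only [Nat.cast_zero, add_zero] at this
      rw [← this]
      refine Finset.sum_congr rfl fun i _ => ?_
      simp only [hb]; push_cast; rw [add_assoc]
    rw [e]
    have h1 := sq_sum_le_card_mul_sum_sq (s := Finset.range k) (f := fun i : ℕ => b (x + i))
    have h2 := sq_sum_le_card_mul_sum_sq (s := Finset.range k) (f := fun i : ℕ => b (x + i) ^ 2)
    simp only [Finset.card_range, ← pow_mul] at h1 h2
    calc (∑ i ∈ Finset.range k, b (x + i)) ^ 4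
        = ((∑ i ∈ Finset.range k, b (x + i)) ^ 2) ^ 2 := by ring
      _ ≤ ((k : ℝ) * ∑ i ∈ Finset.range k, b (x + i) ^ 2) ^ 2 := by gcongr
      _ = (k : ℝ) ^ 2 * (∑ i ∈ Finset.range k, b (x + i) ^ 2) ^ 2 := by ring
      _ ≤ (k : ℝ) ^ 2 * ((k : ℝ) * ∑ i ∈ Finset.range k, b (x + i) ^ 4) := by gcongr
      _ = _ := by ring
  have hsm : Summable (fun x => (F (x + k) - F x) ^ 4) :=
    Summable.of_nonneg_of_le (fun x => by positivity) hle hS.summable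
  exact ⟨hsm, hasSum_le hle hsm.hasSum hS⟩

lemma aux_int_s13 (F : ℤ → ℝ) (hF : Summable fun x => (F (x + 1) - F x) ^ 4) (z : ℤ) :
    Summable (fun x => (F (x + z) - F x) ^ 4) ∧
    ∑' x, (F (x + z) - F x) ^ 4 ≤ (z : ℝ) ^ 4 * ∑' x, (F (x + 1) - F x) ^ 4 := by
  obtain ⟨k, rfl | rfl⟩ := z.eq_nat_or_neg
  · simpa using aux_nat F hF k
  · obtain ⟨h1, h2⟩ := aux_nat F hF k
    have h := ((Equiv.addRight (-(k : ℤ))).hasSum_iff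
      (f := fun x => (F (x + k) - F x) ^ 4)).2 h1.hasSum
    have h' : HasSum (fun x => (F (x + -(k : ℤ)) - F x) ^ 4) (∑' x, (F (x + k) - F x) ^ 4) := by
      convert h using 2 with x
      simp only [Function.comp, Equiv.coe_addRight, neg_add_cancel_right]
      ring
    refine ⟨h'.summable, ?_⟩
    rw [h'.tsum_eq]
    refine h2.trans_eq ?_
    push_cast; ring

set_option maxHeartbeats 1000000 in
/-- There is a constant `c(f)` such that for every `n ≥ 1`,
`(1/n²) ∑_{x,y∈ℤ} s(y−x)² (∇ⁿ_{x,y} f)⁴ ≤ c(f)/n`, where `∇ⁿ_{x,y} f = n (f(y/n) − f(x/n))`. -/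
theorem stmt_13 (s : ℤ → ℝ) (hpos : ∀ z, 0 ≤ s z) (hsym : ∀ z, s (-z) = s z)
    (hzero : s 0 = 0) (hprob : HasSum s 1)
    (hmom : Summable fun z : ℤ => (z : ℝ) ^ 2 * s z)
    (f : SchwartzMap ℝ ℝ) :
    ∃ c : ℝ, ∀ n : ℕ, 1 ≤ n →
      (1 / (n : ℝ) ^ 2) * ∑' x : ℤ, ∑' y : ℤ,
          s (y - x) ^ 2 * ((n : ℝ) * (f ((y : ℝ) / n) - f ((x : ℝ) / n))) ^ 4 ≤ c / n := by
  obtain ⟨K, hK, hf⟩ := aux_deriv_s13 f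
  set T := ∑' z : ℤ, (z : ℝ) ^ 2 * s z with hT
  have hg : Summable (fun q : ℤ => 1 / (1 + (q : ℝ) ^ 2)) := by
    have h2 : Summable (fun q : ℤ => 1 / (q : ℝ) ^ 2) :=
      Real.summable_one_div_int_pow.2 (by norm_num)
    refine Summable.of_norm_bounded_eventually (g := fun q : ℤ => 1 / (q : ℝ) ^ 2) h2 ?_
    have : ∀ᶠ q : ℤ in cofinite, q ≠ 0 := by
      simpa using (Set.finite_singleton (0 : ℤ)).compl_mem_cofinite
    filter_upwards [this] with q hq
    have : (q : ℝ) ≠ 0 := by exact_mod_cast hq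
    rw [Real.norm_of_nonneg (by positivity)]
    gcongr
    linarith
  refine ⟨T * T * (3 * K * ∑' q : ℤ, 1 / (1 + (q : ℝ) ^ 2)), fun n hn => ?_⟩
  have hn0 : (0 : ℝ) < n := by exact_mod_cast hn
  set F : ℤ → ℝ := fun x => (n : ℝ) * f ((x : ℝ) / n) with hFd
  have hD := (aux_div _ hg n hn).mul_left (3 * K)
  have hle : ∀ x, (F (x + 1) - F x) ^ 4 ≤ _ := aux_step f K hK hf n hn
  have hF : Summable fun x => (F (x + 1) - F x) ^ 4 :=
    Summable.of_nonneg_of_le (fun x => by positivity) hle hD.summable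
  have hA := hasSum_le hle hF.hasSum hD
  set A := ∑' x, (F (x + 1) - F x) ^ 4 with hAd
  have hA0 : 0 ≤ A := tsum_nonneg fun x => by positivity
  have hsT : ∀ z : ℤ, (z : ℝ) ^ 2 * s z ≤ T := fun z =>
    hmom.le_tsum z (fun w _ => mul_nonneg (by positivity) (hpos w))
  set G : ℤ × ℤ → ℝ := fun p => s p.1 ^ 2 * (F (p.2 + p.1) - F p.2) ^ 4 with hG
  have hG0 : ∀ p, 0 ≤ G p := fun p => by positivity
  have hBle : ∀ z : ℤ, ∑' x, G (z, x) ≤ T * A * ((z : ℝ) ^ 2 * s z) := by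
    intro z
    simp only [hG, tsum_mul_left]
    have h1 := (aux_int_s13 F hF z).2
    have hz : 0 ≤ (z : ℝ) ^ 2 * s z := mul_nonneg (by positivity) (hpos z)
    calc _ ≤ s z ^ 2 * ((z : ℝ) ^ 4 * A) := by gcongr
      _ = A * (((z : ℝ) ^ 2 * s z) * ((z : ℝ) ^ 2 * s z)) := by ring
      _ ≤ A * (T * ((z : ℝ) ^ 2 * s z)) := by gcongr; exact hsT z
      _ = _ := by ring
  have hBs : Summable (fun z : ℤ => ∑' x, G (z, x)) :=
    Summable.of_nonneg_of_le (fun z => tsum_nonneg fun x => hG0 _) hBle (hmom.mul_left _)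
  have hGs : Summable G := (summable_prod_of_nonneg hG0).2
    ⟨fun z => (aux_int_s13 F hF z).1.mul_left (s z ^ 2), hBs⟩
  have key : ∑' x : ℤ, ∑' y : ℤ,
      s (y - x) ^ 2 * ((n : ℝ) * (f ((y : ℝ) / n) - f ((x : ℝ) / n))) ^ 4
      = ∑' z, ∑' x, G (z, x) := by
    rw [← hGs.tsum_comm (f := fun z x => G (z, x))]
    refine tsum_congr fun x => ?_
    rw [← (Equiv.addLeft x).tsum_eq]
    refine tsum_congr fun z => ?_
    simp only [hG, hFd, Equiv.coe_addLeft, add_sub_cancel_left]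
    ring
  rw [key]
  have hfin := hasSum_le hBle hBs.hasSum (hmom.hasSum.mul_left _)
  have hT0 : 0 ≤ T := tsum_nonneg fun z => mul_nonneg (by positivity) (hpos z)
  calc _ ≤ (1 / (n : ℝ) ^ 2) * (T * A * T) := by gcongr
    _ ≤ (1 / (n : ℝ) ^ 2) *
        (T * (3 * K * (n * ∑' q : ℤ, 1 / (1 + (q : ℝ) ^ 2))) * T) := by gcongr
    _ = _ := by field_simp
end

section
/- Let s : ℤ → ℝ be a symmetric transition probability with finite second moment, let a : ℤ → ℝ be antisymmetric with |a(z)| ≤ C s(z) for all z and some finite constant C, and let f be a Schwartz function on ℝ. Then there exists a finite constant c(f) such that for every n ≥ 1, (1/n²) ∑_{x∈ℤ} ( ∑_{y∈ℤ} a(y−x) ( n ( f(y/n) − f(x/n) ) )² )² ≤ c(f)/n. -/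
open Filter

lemma aux_unit (g φ : ℝ → ℝ) (hg : ∀ u, HasDerivAt g (φ u) u) (hφ : Continuous φ)
    (hi : MeasureTheory.Integrable (fun u => φ u ^ 2)) (F : Finset ℤ) :
    ∑ x ∈ F, (g ((x : ℝ) + 1) - g x) ^ 2 ≤ ∫ u, φ u ^ 2 := by
  have h1 : ∀ x : ℤ, (g ((x : ℝ) + 1) - g x) ^ 2
      ≤ ∫ u in Set.Ioc (x : ℝ) ((x : ℝ) + 1), φ u ^ 2 := by
    intro x
    have hle : (x : ℝ) ≤ x + 1 := by linarith
    set d := g ((x : ℝ) + 1) - g x with hd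
    have hint : ∫ u in (x : ℝ)..((x : ℝ) + 1), φ u = d :=
      intervalIntegral.integral_eq_sub_of_hasDerivAt (fun u _ => hg u)
        (hφ.intervalIntegrable _ _)
    rw [← intervalIntegral.integral_of_le hle]
    have h2 : ∫ u in (x : ℝ)..((x : ℝ) + 1), (2 * d * φ u - d ^ 2)
        ≤ ∫ u in (x : ℝ)..((x : ℝ) + 1), φ u ^ 2 := by
      apply intervalIntegral.integral_mono_on hle
      · exact (by fun_prop : Continuous fun u => 2 * d * φ u - d ^ 2).intervalIntegrable _ _
      · exact (by fun_prop : Continuous fun u => φ u ^ 2).intervalIntegrable _ _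
      · intro u _
        nlinarith [sq_nonneg (φ u - d)]
    rw [intervalIntegral.integral_sub
      ((by fun_prop : Continuous fun u => 2 * d * φ u).intervalIntegrable _ _)
      (continuous_const.intervalIntegrable _ _),
      intervalIntegral.integral_const_mul, hint, intervalIntegral.integral_const] at h2
    simp only [add_sub_cancel_left, one_smul] at h2
    nlinarith
  calc _ ≤ ∑ x ∈ F, ∫ u in Set.Ioc (x : ℝ) ((x : ℝ) + 1), φ u ^ 2 :=
        Finset.sum_le_sum fun x _ => h1 x
    _ = ∫ u in ⋃ x ∈ F, Set.Ioc (x : ℝ) ((x : ℝ) + 1), φ u ^ 2 := by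
        rw [MeasureTheory.integral_biUnion_finset]
        · intro i _; exact measurableSet_Ioc
        · exact (Set.pairwise_disjoint_Ioc_intCast ℝ).set_pairwise _
        · intro i _; exact hi.integrableOn
    _ ≤ _ := MeasureTheory.setIntegral_le_integral hi
        (Filter.Eventually.of_forall fun u => sq_nonneg _)

lemma aux_nat_s14 (g : ℤ → ℝ) (D : ℝ)
    (hD : ∀ F : Finset ℤ, ∑ x ∈ F, (g (x + 1) - g x) ^ 2 ≤ D) (m : ℕ) (F : Finset ℤ) :
    ∑ x ∈ F, (g (x + m) - g x) ^ 2 ≤ (m : ℝ) ^ 2 * D := by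
  have h1 : ∀ x : ℤ, (g (x + m) - g x) ^ 2
      ≤ m * ∑ k ∈ Finset.range m, (g (x + k + 1) - g (x + k)) ^ 2 := by
    intro x
    have := Finset.sum_range_sub (fun k : ℕ => g (x + k)) m
    simp only [Nat.cast_zero, add_zero, Nat.cast_add, Nat.cast_one, ← add_assoc] at this
    rw [← this]
    simpa using sq_sum_le_card_mul_sum_sq (s := Finset.range m)
      (f := fun k : ℕ => g (x + k + 1) - g (x + k))
  calc _ ≤ ∑ x ∈ F, (m : ℝ) * ∑ k ∈ Finset.range m, (g (x + k + 1) - g (x + k)) ^ 2 :=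
        Finset.sum_le_sum fun x _ => h1 x
    _ = m * ∑ k ∈ Finset.range m, ∑ x ∈ F, (g (x + k + 1) - g (x + k)) ^ 2 := by
        rw [← Finset.mul_sum, Finset.sum_comm]
    _ ≤ m * ∑ k ∈ Finset.range m, D := by
        gcongr with k _
        have := hD (F.map (addRightEmbedding (k : ℤ)))
        simpa using this
    _ = _ := by simp; ring

lemma aux_int_s14 (g : ℤ → ℝ) (D : ℝ)
    (hD : ∀ F : Finset ℤ, ∑ x ∈ F, (g (x + 1) - g x) ^ 2 ≤ D) (z : ℤ) (F : Finset ℤ) :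
    ∑ x ∈ F, (g (x + z) - g x) ^ 2 ≤ (z : ℝ) ^ 2 * D := by
  obtain ⟨m, rfl | rfl⟩ := z.eq_nat_or_neg
  · simpa using aux_nat_s14 g D hD m F
  · have := aux_nat_s14 g D hD m (F.map (addRightEmbedding (-(m : ℤ))))
    simp only [Finset.sum_map, addRightEmbedding_apply, neg_add_cancel_right] at this
    refine le_trans (le_of_eq ?_) (this.trans (le_of_eq ?_))
    · exact Finset.sum_congr rfl fun x _ => by ring
    · push_cast; ring

/-- There is a constant `c(f)` such that for every `n ≥ 1`,
`(1/n²) ∑_{x∈ℤ} (∑_{y∈ℤ} a(y−x) (∇ⁿ_{x,y} f)²)² ≤ c(f)/n`, where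
`∇ⁿ_{x,y} f = n (f(y/n) − f(x/n))`. -/
theorem stmt_14 (s a : ℤ → ℝ) (hpos : ∀ z, 0 ≤ s z) (hsym : ∀ z, s (-z) = s z)
    (hzero : s 0 = 0) (hprob : HasSum s 1)
    (hmom : Summable fun z : ℤ => (z : ℝ) ^ 2 * s z)
    (hanti : ∀ z, a (-z) = -a z)
    (C : ℝ) (hC : ∀ z, |a z| ≤ C * s z)
    (f : SchwartzMap ℝ ℝ) :
    ∃ c : ℝ, ∀ n : ℕ, 1 ≤ n →
      (1 / (n : ℝ) ^ 2) * ∑' x : ℤ,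
          (∑' y : ℤ, a (y - x) * ((n : ℝ) * (f ((y : ℝ) / n) - f ((x : ℝ) / n))) ^ 2) ^ 2
        ≤ c / n := by
  set S : ℝ := ∑' z : ℤ, (z : ℝ) ^ 2 * s z with hS
  have hS0 : 0 ≤ S := tsum_nonneg fun z => mul_nonneg (sq_nonneg _) (hpos z)
  set f' : SchwartzMap ℝ ℝ := SchwartzMap.derivCLM ℝ ℝ f with hf'
  have hder : ∀ u, HasDerivAt f (f' u) u := fun u => by
    rw [hf', SchwartzMap.derivCLM_apply]
    exact f.differentiableAt.hasDerivAt
  obtain ⟨L, hL⟩ : ∃ L : ℝ, ∀ u, ‖f' u‖ ≤ L :=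
    ⟨_, fun u => SchwartzMap.norm_le_seminorm ℝ f' u⟩
  have hLip : ∀ u v, |f v - f u| ≤ L * |v - u| := fun u v => by
    have := Convex.norm_image_sub_le_of_norm_hasDerivWithin_le (f := f) (f' := f') (C := L)
      (s := Set.univ) (fun x _ => (hder x).hasDerivWithinAt) (fun x _ => hL x) convex_univ
      (Set.mem_univ u) (Set.mem_univ v)
    simpa [Real.norm_eq_abs] using this
  have hint : MeasureTheory.Integrable (fun u => f' u ^ 2) :=
    (f'.memLp 2).integrable_sq
  set B : ℝ := ∫ u, f' u ^ 2 with hB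
  have hC' : ∀ z, |a z| ≤ |C| * s z := fun z =>
    (hC z).trans (mul_le_mul_of_nonneg_right (le_abs_self C) (hpos z))
  refine ⟨|C| * (L ^ 2 * S) * (|C| * (S * B)), fun n hn => ?_⟩
  have hn0 : (0 : ℝ) < n := by exact_mod_cast hn
  set h : ℤ → ℤ → ℝ := fun z x => ((n : ℝ) * (f (((x + z : ℤ) : ℝ) / n) - f ((x : ℝ) / n))) ^ 2
    with hh
  have hh0 : ∀ z x, 0 ≤ h z x := fun z x => sq_nonneg _
  have hhL : ∀ z x, h z x ≤ L ^ 2 * (z : ℝ) ^ 2 := by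
    intro z x
    have := hLip ((x : ℝ) / n) (((x + z : ℤ) : ℝ) / n)
    have e : ((x + z : ℤ) : ℝ) / n - (x : ℝ) / n = z / n := by push_cast; ring
    rw [e, abs_div, abs_of_pos hn0] at this
    have h2 : |(n : ℝ) * (f (((x + z : ℤ) : ℝ) / n) - f ((x : ℝ) / n))| ≤ L * |(z : ℝ)| := by
      rw [abs_mul, abs_of_pos hn0]
      calc _ ≤ (n : ℝ) * (L * (|(z : ℝ)| / n)) := by gcongr
        _ = _ := by field_simp
    calc h z x = |(n : ℝ) * (f (((x + z : ℤ) : ℝ) / n) - f ((x : ℝ) / n))| ^ 2 := by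
          rw [sq_abs]
      _ ≤ (L * |(z : ℝ)|) ^ 2 := by gcongr
      _ = _ := by rw [mul_pow, sq_abs]
  -- sums over x
  have hsumx : ∀ (z : ℤ) (F : Finset ℤ), ∑ x ∈ F, h z x ≤ (z : ℝ) ^ 2 * (n * B) := by
    intro z F
    have hu : ∀ F : Finset ℤ, ∑ x ∈ F,
        (f (((x + 1 : ℤ) : ℝ) / n) - f ((x : ℝ) / n)) ^ 2 ≤ B / n := by
      intro F
      have := aux_unit (fun u => f (u / n)) (fun u => f' (u / n) * (1 / n))
        (fun u => (hder (u / n)).comp u ((hasDerivAt_id u).div_const (n : ℝ)))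
        (by have := f'.continuous; fun_prop)
        (by
          simp only [mul_pow]
          exact (hint.comp_div hn0.ne').mul_const _) F
      simp only [mul_pow] at this
      rw [MeasureTheory.integral_mul_const,
        MeasureTheory.Measure.integral_comp_div (fun u => f' u ^ 2) (n : ℝ)] at this
      simp only [smul_eq_mul, abs_of_pos hn0, ← hB] at this
      push_cast
      refine this.trans (le_of_eq ?_)
      field_simp
    have := aux_int_s14 (fun x => f ((x : ℝ) / n)) (B / n) hu z F
    simp only [hh, mul_pow, ← Finset.mul_sum]
    calc _ ≤ (n : ℝ) ^ 2 * ((z : ℝ) ^ 2 * (B / n)) := by gcongr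
      _ = _ := by field_simp
  -- the inner sums
  set H : ℤ → ℝ := fun x => ∑' z : ℤ, s z * h z x with hH
  have hsm : ∀ x, Summable fun z => s z * h z x := fun x =>
    Summable.of_nonneg_of_le (fun z => mul_nonneg (hpos z) (hh0 z x))
      (fun z => (mul_le_mul_of_nonneg_left (hhL z x) (hpos z)).trans (le_of_eq (by ring)))
      (hmom.mul_left (L ^ 2))
  have hH0 : ∀ x, 0 ≤ H x := fun x => tsum_nonneg fun z => mul_nonneg (hpos z) (hh0 z x)
  have hHle : ∀ x, H x ≤ L ^ 2 * S := by
    intro x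
    rw [hS, ← tsum_mul_left]
    exact (hsm x).tsum_le_tsum
      (fun z => (mul_le_mul_of_nonneg_left (hhL z x) (hpos z)).trans (le_of_eq (by ring)))
      (hmom.mul_left (L ^ 2))
  have hHsum : ∀ F : Finset ℤ, ∑ x ∈ F, H x ≤ S * (n * B) := by
    intro F
    rw [hH, ← Summable.tsum_finsetSum (fun x _ => hsm x), hS, ← tsum_mul_right]
    refine Summable.tsum_le_tsum (fun z => ?_) (summable_sum fun x _ => hsm x)
      (hmom.mul_right _)
    rw [← Finset.mul_sum]
    exact (mul_le_mul_of_nonneg_left (hsumx z F) (hpos z)).trans (le_of_eq (by ring))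
  have hG : ∀ x : ℤ,
      |∑' y : ℤ, a (y - x) * ((n : ℝ) * (f ((y : ℝ) / n) - f ((x : ℝ) / n))) ^ 2|
        ≤ |C| * H x := by
    intro x
    have e : ∑' y : ℤ, a (y - x) * ((n : ℝ) * (f ((y : ℝ) / n) - f ((x : ℝ) / n))) ^ 2
        = ∑' z : ℤ, a z * h z x := by
      rw [← (Equiv.addLeft x).tsum_eq]
      simp [hh]
    rw [e, hH, ← Real.norm_eq_abs]
    refine tsum_of_norm_bounded ((hsm x).mul_left |C|).hasSum (fun z => ?_) |>.trans
      (le_of_eq tsum_mul_left)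
    rw [Real.norm_eq_abs, abs_mul, abs_of_nonneg (hh0 z x), ← mul_assoc]
    exact mul_le_mul_of_nonneg_right (hC' z) (hh0 z x)
  have hB0 : 0 ≤ B := MeasureTheory.integral_nonneg fun u => sq_nonneg _
  have hfin : ∑' x : ℤ,
      (∑' y : ℤ, a (y - x) * ((n : ℝ) * (f ((y : ℝ) / n) - f ((x : ℝ) / n))) ^ 2) ^ 2
        ≤ |C| * (L ^ 2 * S) * (|C| * (S * (n * B))) := by
    refine Real.tsum_le_of_sum_le (fun x => sq_nonneg _) fun F => ?_
    calc _ ≤ ∑ x ∈ F, |C| * (L ^ 2 * S) * (|C| * H x) := by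
          refine Finset.sum_le_sum fun x _ => ?_
          rw [← sq_abs, sq]
          have h1 := hG x
          have h2 : |C| * H x ≤ |C| * (L ^ 2 * S) :=
            mul_le_mul_of_nonneg_left (hHle x) (abs_nonneg C)
          exact mul_le_mul (h1.trans h2) h1 (abs_nonneg _) (by positivity)
      _ = |C| * (L ^ 2 * S) * (|C| * ∑ x ∈ F, H x) := by
          rw [← Finset.mul_sum, ← Finset.mul_sum]
      _ ≤ _ := by
          have := hHsum F
          gcongr
  calc _ ≤ (1 / (n : ℝ) ^ 2) * (|C| * (L ^ 2 * S) * (|C| * (S * (n * B)))) := by gcongr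
    _ = _ := by field_simp
end
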